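/- Let 𝒞_P be the flat infinite cylinder with circumference P > 0, and let V be a Lipschitz set on 𝒞_P with first Dirichlet eigenvalue equal to λ. Then Area(V) ≥ min{π λ₁(𝔻) λ^{−1}, P λ₁(𝔻)^{1/2} λ^{−1/2}}. -/

import Mathlib

/-!
Common definitions formalizing the setting of
"Nodal domain count for Neumann eigenfunctions of chain domains"
(Beck–Canzani–Marzuola): planar chain domains, Neumann eigenfunctions (in weak
variational form), nodal domains, the δ-partition and adapted partitions of
unity, classes of nodal domains, first Dirichlet eigenvalues via Rayleigh
quotients, and flat cylinders (encoded by periodic subsets of the plane).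
-/

open MeasureTheory Metric Set Filter
open scoped RealInnerProductSpace BigOperators ENNReal NNReal

noncomputable section

/-- Points of the Euclidean plane. -/
abbrev Pt : Type := EuclideanSpace ℝ (Fin 2)

/-- Two-dimensional Lebesgue area of a planar set. -/
noncomputable def area (s : Set Pt) : ℝ := (volume s).toReal

/-- `u` is a (weak, variational) Neumann Laplace eigenfunction on `Ω` with eigenvalue `μ`:
it is nontrivial and for every `C¹` test function `φ` (not required to vanish on `∂Ω`,
which encodes the Neumann boundary condition) one has
`∫_Ω ⟨∇u, ∇φ⟩ = μ ∫_Ω u φ`. -/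
structure IsNeumannEigenfunction (Ω : Set Pt) (u : Pt → ℝ) (μ : ℝ) : Prop where
  contDiffOn : ContDiffOn ℝ 2 u Ω
  nontrivial : ∃ x ∈ Ω, u x ≠ 0
  weakForm : ∀ φ : Pt → ℝ, ContDiff ℝ 1 φ →
    (∫ x in Ω, ⟪gradient u x, gradient φ x⟫) = μ * ∫ x in Ω, u x * φ x

/-- `D` is a nodal domain of `u` on `Ω`, i.e. a connected component of `{x ∈ Ω | u x ≠ 0}`. -/
def IsNodalDomain (Ω : Set Pt) (u : Pt → ℝ) (D : Set Pt) : Prop :=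
  ∃ x, x ∈ Ω ∧ u x ≠ 0 ∧ D = connectedComponentIn {y | y ∈ Ω ∧ u y ≠ 0} x

/-- `ν(u)`: the number of nodal domains of `u` on `Ω`. -/
noncomputable def nodalCount (Ω : Set Pt) (u : Pt → ℝ) : ℕ :=
  Set.ncard {D | IsNodalDomain Ω u D}

/-- The first Dirichlet eigenvalue of a planar set `V`, defined as the infimum of the
Rayleigh quotients of nontrivial `C¹` functions compactly supported in `V`. -/
noncomputable def firstDirichletEV (V : Set Pt) : ℝ :=
  sInf {r | ∃ v : Pt → ℝ, ContDiff ℝ 1 v ∧ HasCompactSupport v ∧ tsupport v ⊆ V ∧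
    (∫ x in V, (v x) ^ 2) ≠ 0 ∧
    r = (∫ x in V, ‖gradient v x‖ ^ 2) / ∫ x in V, (v x) ^ 2}

/-- `λ₁(𝔻)`: the first Dirichlet eigenvalue of the unit disc. -/
noncomputable def lambda1Disk : ℝ := firstDirichletEV (Metric.ball (0 : Pt) 1)

/-- An abstract planar chain domain `Ω(𝐰)`: a bounded open planar set, together with its
boundary length `L(𝐰)`, the five geometric constants `ρ*, κ*, δ*, τ*, w*` of the underlying
base domain, the pieces `D_ℓ`, the vertices (with their interior angles and angle-bisector
directions), the necks `𝒩_{ij,k}(𝐰)` (with their minimum widths `w_{ij,k}`), and its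
`δ`-partition `Ω = ⋃_{j=0}^{4} Ω_j^δ(𝐰)`. -/
structure ChainDomain where
  /-- the underlying planar set `Ω(𝐰)` -/
  carrier : Set Pt
  isOpen : IsOpen carrier
  bounded : Bornology.IsBounded carrier
  nonempty : carrier.Nonempty
  /-- the length `L(𝐰)` of the boundary `∂Ω(𝐰)` -/
  L : ℝ
  L_pos : 0 < L
  /-- isoperimetric ratio constant `ρ*` -/
  rho : ℝ
  /-- normalized curvature constant `κ*` -/
  kap : ℝ
  /-- vertex control constant `δ*` -/
  dstar : ℝ
  /-- normalized cut-distance constant `τ*` -/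
  tau : ℝ
  /-- neck-width constant `w*` -/
  wstar : ℝ
  rho_pos : 0 < rho
  kap_pos : 0 < kap
  dstar_pos : 0 < dstar
  tau_pos : 0 < tau
  wstar_pos : 0 < wstar
  /-- the isoperimetric ratio `L(𝐰)²/|Ω(𝐰)|` is bounded by `ρ*` -/
  isoperimetric : L ^ 2 ≤ rho * area carrier
  /-- the number `M` of planar pieces -/
  M : ℕ
  /-- the planar pieces `D_ℓ` -/
  piece : Fin M → Set Pt
  piece_subset : ∀ ℓ, piece ℓ ⊆ carrier
  /-- the vertices of `∂Ω(𝐰)` -/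
  vertices : Finset Pt
  vertices_boundary : ∀ v ∈ vertices, v ∈ frontier carrier
  /-- the interior angle at each vertex -/
  angle : Pt → ℝ
  angle_range : ∀ v ∈ vertices, 0 < angle v ∧ angle v < 2 * Real.pi
  /-- the direction of the interior angle bisector at each vertex -/
  bisector : Pt → Pt
  /-- the number of necks -/
  numNecks : ℕ
  /-- the necks `𝒩_{ij,k}(𝐰)` -/
  neck : Fin numNecks → Set Pt
  neck_subset : ∀ i, neck i ⊆ carrier
  /-- the minimum width `w_{ij,k}` of each neck -/
  width : Fin numNecks → ℝ
  width_pos : ∀ i, 0 < width i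
  /-- `Ω(𝐰)` is covered by the pieces and the necks -/
  cover : carrier ⊆ (⋃ ℓ, piece ℓ) ∪ (⋃ i, neck i)
  /-- the `δ`-partition `{Ω_j^δ(𝐰)}_{j=0}^4` -/
  part : ℝ → Fin 5 → Set Pt
  part_subset : ∀ δ j, part δ j ⊆ carrier
  part_cover : ∀ δ : ℝ, 0 < δ → δ ≤ min (L * dstar / 20) (L / (kap * tau)) →
    carrier ⊆ ⋃ j, part δ j

/-- `δ` is admissible for the `δ`-partition:
`0 < δ ≤ min{ L(𝐰)δ*/20 , L(𝐰)/(κ*τ*) }`. -/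
def ChainDomain.admissible (cd : ChainDomain) (δ : ℝ) : Prop :=
  0 < δ ∧ δ ≤ min (cd.L * cd.dstar / 20) (cd.L / (cd.kap * cd.tau))

/-- A partition of unity `{χ_j^δ}_{j=0}^4` adapted (subordinate) to the `δ`-partition of the
chain domain `cd`, with gradient bound `c/δ`. -/
structure IsAdaptedPartition (cd : ChainDomain) (c δ : ℝ) (χ : Fin 5 → Pt → ℝ) : Prop where
  cont : ∀ j, Continuous (χ j)
  sq_sum : ∀ x ∈ cd.carrier, (∑ j : Fin 5, (χ j x) ^ 2) = 1
  localized : ∀ j, ∀ x ∈ cd.carrier, χ j x ≠ 0 → ∃ y ∈ cd.part δ j, dist x y ≤ δ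
  grad_le : ∀ j, ∀ᵐ x ∂(volume.restrict cd.carrier),
    DifferentiableAt ℝ (χ j) x ∧ ‖gradient (χ j) x‖ ≤ c / δ

/-- The squared `L²(D)`-norm (mass) of `f`. -/
noncomputable def mass (D : Set Pt) (f : Pt → ℝ) : ℝ := ∫ x in D, (f x) ^ 2

/-- `D ∈ 𝒱₀^δ(ε;u)`: a bulk nodal domain, `‖χ₀^δ u‖²_{L²(D)} ≥ (1-ε)‖u‖²_{L²(D)}`. -/
def IsBulkND (cd : ChainDomain) (ε : ℝ) (u : Pt → ℝ) (χ : Fin 5 → Pt → ℝ) (D : Set Pt) : Prop :=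
  IsNodalDomain cd.carrier u D ∧ (1 - ε) * mass D u ≤ mass D fun x => χ 0 x * u x

/-- `D ∈ 𝒱₁^δ(ε;u)`: a boundary nodal domain, `‖χ₁^δ u‖²_{L²(D)} ≥ (ε/4)‖u‖²_{L²(D)}`. -/
def IsBoundaryND (cd : ChainDomain) (ε : ℝ) (u : Pt → ℝ) (χ : Fin 5 → Pt → ℝ) (D : Set Pt) :
    Prop :=
  IsNodalDomain cd.carrier u D ∧ ε / 4 * mass D u ≤ mass D fun x => χ 1 x * u x

/-- `D ∈ 𝒱₂^δ(ε;u)`: a corner nodal domain, `‖χ₂^δ u‖²_{L²(D)} ≥ (ε/4)‖u‖²_{L²(D)}` or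
`‖χ₄^δ u‖²_{L²(D ∩ ⋃_ℓ D_ℓ)} ≥ (ε/8)‖u‖²_{L²(D)}`. -/
def IsCornerND (cd : ChainDomain) (ε : ℝ) (u : Pt → ℝ) (χ : Fin 5 → Pt → ℝ) (D : Set Pt) :
    Prop :=
  IsNodalDomain cd.carrier u D ∧
    (ε / 4 * mass D u ≤ mass D (fun x => χ 2 x * u x) ∨
      ε / 8 * mass D u ≤ mass (D ∩ ⋃ ℓ, cd.piece ℓ) fun x => χ 4 x * u x)

/-- `D ∈ 𝒱₃^δ(ε;u)`: a neck nodal domain, `‖χ₃^δ u‖²_{L²(D)} ≥ (ε/4)‖u‖²_{L²(D)}` or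
`‖χ₄^δ u‖²_{L²(D ∩ ⋃ 𝒩_{ij,k}(𝐰))} ≥ (ε/8)‖u‖²_{L²(D)}`. -/
def IsNeckND (cd : ChainDomain) (ε : ℝ) (u : Pt → ℝ) (χ : Fin 5 → Pt → ℝ) (D : Set Pt) :
    Prop :=
  IsNodalDomain cd.carrier u D ∧
    (ε / 4 * mass D u ≤ mass D (fun x => χ 3 x * u x) ∨
      ε / 8 * mass D u ≤ mass (D ∩ ⋃ i, cd.neck i) fun x => χ 4 x * u x)

/-- `(u_m)_{m≥1}` and `(μ_m)_{m≥1}` form the complete system of Neumann eigenfunctions and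
eigenvalues of `Ω`: `0 = μ₁ ≤ μ₂ ≤ …`, every Neumann eigenvalue occurs in the list, and the
spectrum is discrete. -/
structure IsNeumannSystem (Ω : Set Pt) (u : ℕ → Pt → ℝ) (μ : ℕ → ℝ) : Prop where
  eig : ∀ m, 1 ≤ m → IsNeumannEigenfunction Ω (u m) (μ m)
  mono : ∀ m n, 1 ≤ m → m ≤ n → μ m ≤ μ n
  first : μ 1 = 0
  complete : ∀ (lam : ℝ) (v : Pt → ℝ), IsNeumannEigenfunction Ω v lam → ∃ m, 1 ≤ m ∧ μ m = lam
  discrete : ∀ lam : ℝ, {m | 1 ≤ m ∧ μ m < lam}.Finite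

/-- The Neumann eigenvalue counting function `𝒩^N(μ) = #{k ≥ 1 : μ_k < μ}`. -/
noncomputable def neumannCount (μ : ℕ → ℝ) (lam : ℝ) : ℕ := Set.ncard {m | 1 ≤ m ∧ μ m < lam}

/-- `V` has a Lipschitz boundary: near each boundary point, `V` is, in suitable orthonormal
coordinates, the region strictly above the graph of a Lipschitz function. -/
def HasLipschitzBoundary (V : Set Pt) : Prop :=
  ∀ x ∈ frontier V, ∃ (e : Pt ≃ₗᵢ[ℝ] Pt) (K : NNReal) (f : ℝ → ℝ) (r : ℝ),
    0 < r ∧ LipschitzWith K f ∧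
    V ∩ Metric.ball x r = {y ∈ Metric.ball x r | f ((e y) 0) < (e y) 1}

/-- A proxy for membership `v ∈ H¹(V)`. -/
structure MemH1 (V : Set Pt) (v : Pt → ℝ) : Prop where
  cont : ContinuousOn v (closure V)
  diffAE : ∀ᵐ x ∂(volume.restrict V), DifferentiableAt ℝ v x

/-- A proxy for membership `v ∈ H₀¹(V)`: additionally `v` vanishes outside `V`. -/
structure MemH10 (V : Set Pt) (v : Pt → ℝ) : Prop where
  cont : Continuous v
  zero : ∀ x ∉ V, v x = 0
  diffAE : ∀ᵐ x ∂(volume.restrict V), DifferentiableAt ℝ v x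

/-- The vector by which a period-`P` cylinder is generated in the plane. -/
noncomputable def cylShift (P : ℝ) : Pt := EuclideanSpace.single (1 : Fin 2) P

/-- A subset of the flat cylinder `𝒞_P = ℝ × (ℝ/Pℤ)`, encoded as a `P`-periodic
subset of the plane. -/
def IsPeriodicSet (P : ℝ) (V : Set Pt) : Prop := ∀ x : Pt, x ∈ V ↔ x + cylShift P ∈ V

/-- A function on the flat cylinder `𝒞_P`, encoded as a `P`-periodic function on the plane. -/
def IsPeriodicFun (P : ℝ) (v : Pt → ℝ) : Prop := ∀ x : Pt, v (x + cylShift P) = v x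

/-- A fundamental domain for the cylinder `𝒞_P` inside the plane. -/
def cylFund (P : ℝ) : Set Pt := {x : Pt | x 1 ∈ Set.Ico (0 : ℝ) P}

/-- The area on `𝒞_P` of (the periodic set encoding) `V ⊆ 𝒞_P`. -/
noncomputable def cylArea (P : ℝ) (V : Set Pt) : ℝ := area (V ∩ cylFund P)

/-- The first Dirichlet eigenvalue of `V ⊆ 𝒞_P`, via Rayleigh quotients of nontrivial
`C¹` periodic functions vanishing outside `V`. -/
noncomputable def cylFirstDirichletEV (P : ℝ) (V : Set Pt) : ℝ :=
  sInf {r | ∃ v : Pt → ℝ, ContDiff ℝ 1 v ∧ IsPeriodicFun P v ∧ (∀ x ∉ V, v x = 0) ∧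
    (∫ x in V ∩ cylFund P, (v x) ^ 2) ≠ 0 ∧
    r = (∫ x in V ∩ cylFund P, ‖gradient v x‖ ^ 2) / ∫ x in V ∩ cylFund P, (v x) ^ 2}

/-- The open sector `S_{v₀,θ₀}(δ) = {(r,θ) ∈ Ω(𝐰) : r < δ, |θ| < θ₀/2}` of radius `δ` and
aperture `θ₀` at the vertex `v₀` (in polar coordinates centered at `v₀`, measured from the
angle bisector). -/
def sector (cd : ChainDomain) (v₀ : Pt) (θ₀ δ : ℝ) : Set Pt :=
  {x ∈ cd.carrier | dist x v₀ < δ ∧ InnerProductGeometry.angle (x - v₀) (cd.bisector v₀) < θ₀ / 2}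

/-- The (2×2) determinant of the pair of plane vectors `a, b`. -/
noncomputable def jac2 (a b : Pt) : ℝ := a 0 * b 1 - a 1 * b 0

section

open scoped Pointwise Topology

theorem IsCompact.volume_add_le_volume_add {K L : Set ℝ} (hK : IsCompact K) (hL : IsCompact L)
    (hK0 : K.Nonempty) (hL0 : L.Nonempty) : volume K + volume L ≤ volume (K + L) := by
  obtain ⟨k, hk, hk'⟩ := hK.exists_isGreatest hK0
  obtain ⟨l, hl, hl'⟩ := hL.exists_isLeast hL0
  have h1 : volume ((fun x => x + l) '' K) = volume K := by
    rw [image_add_right, measure_preimage_add_right]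
  have h2 : volume ((fun x => k + x) '' L) = volume L := by
    rw [image_add_left, measure_preimage_add]
  have hd : AEDisjoint volume ((fun x => x + l) '' K) ((fun x => k + x) '' L) := by
    refine measure_mono_null (t := {k + l}) ?_ (by simp)
    rintro _ ⟨⟨x, hx, rfl⟩, ⟨y, hy, hxy⟩⟩
    have := hk' hx
    have := hl' hy
    simp only [mem_singleton_iff] at *
    linarith
  rw [← h1, ← h2, ← measure_union₀ (hL.image (by fun_prop)).measurableSet.nullMeasurableSet hd]
  refine measure_mono (union_subset ?_ ?_)
  · rintro _ ⟨x, hx, rfl⟩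
    exact add_mem_add hx hl
  · rintro _ ⟨x, hx, rfl⟩
    exact add_mem_add hk hx

/-- One-dimensional Brunn–Minkowski inequality. -/
theorem volume_add_le_volume_add {A B : Set ℝ} (hA : MeasurableSet A) (hB : MeasurableSet B)
    (hA0 : A.Nonempty) (hB0 : B.Nonempty) : volume A + volume B ≤ volume (A + B) := by
  obtain ⟨a, ha⟩ := hA0
  obtain ⟨b, hb⟩ := hB0
  rw [hA.measure_eq_iSup_isCompact, hB.measure_eq_iSup_isCompact]
  simp only [iSup_and']
  refine ENNReal.biSup_add_biSup_le' (p := fun K => K ⊆ A ∧ IsCompact K)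
    (q := fun K => K ⊆ B ∧ IsCompact K) ⟨∅, empty_subset A, isCompact_empty⟩
    ⟨∅, empty_subset B, isCompact_empty⟩ ?_
  rintro K ⟨hKA, hK⟩ L ⟨hLB, hL⟩
  calc volume K + volume L ≤ volume (insert a K) + volume (insert b L) := by
        gcongr <;> exact subset_insert _ _
    _ ≤ volume (insert a K + insert b L) :=
        (hK.insert a).volume_add_le_volume_add (hL.insert b) (insert_nonempty _ _)
          (insert_nonempty _ _)
    _ ≤ volume (A + B) := measure_mono
        (add_subset_add (insert_subset ha hKA) (insert_subset hb hLB))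

/-- Length of the vertical section of a planar set. -/
noncomputable def sectionLength (A : Set (ℝ × ℝ)) (x : ℝ) : ℝ := (volume (Prod.mk x ⁻¹' A)).toReal

theorem sectionLength_nonneg (A : Set (ℝ × ℝ)) (x : ℝ) : 0 ≤ sectionLength A x :=
  ENNReal.toReal_nonneg

theorem measurable_sectionLength {A : Set (ℝ × ℝ)} (hA : MeasurableSet A) :
    Measurable (sectionLength A) :=
  (measurable_measure_prodMk_left hA).ennreal_toReal

theorem exists_volume_section_le {A : Set (ℝ × ℝ)} (hb : Bornology.IsBounded A) :
    ∃ M : ℝ, ∀ x, volume (Prod.mk x ⁻¹' A) ≤ ENNReal.ofReal M := by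
  obtain ⟨r, hr⟩ := hb.subset_closedBall 0
  refine ⟨2 * r, fun x => ?_⟩
  rw [← Real.volume_closedBall (0 : ℝ) r]
  refine measure_mono fun y hy => ?_
  have := hr hy
  rw [mem_closedBall, dist_zero_right, Prod.norm_def] at this
  rw [mem_closedBall, dist_zero_right]
  exact (le_max_right _ _).trans this

theorem ofReal_sectionLength {A : Set (ℝ × ℝ)} (hb : Bornology.IsBounded A) (x : ℝ) :
    ENNReal.ofReal (sectionLength A x) = volume (Prod.mk x ⁻¹' A) := by
  obtain ⟨M, hM⟩ := exists_volume_section_le hb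
  exact ENNReal.ofReal_toReal ((hM x).trans_lt ENNReal.ofReal_lt_top).ne

theorem bddAbove_range_sectionLength {A : Set (ℝ × ℝ)} (hb : Bornology.IsBounded A) :
    BddAbove (range (sectionLength A)) := by
  obtain ⟨M, hM⟩ := exists_volume_section_le hb
  refine ⟨max M 0, ?_⟩
  rintro _ ⟨x, rfl⟩
  exact ENNReal.toReal_le_of_le_ofReal (le_max_right _ _)
    ((hM x).trans (ENNReal.ofReal_le_ofReal (le_max_left _ _)))

theorem sectionLength_iSup_pos {A : Set (ℝ × ℝ)} (ho : IsOpen A) (hb : Bornology.IsBounded A)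
    (h0 : A.Nonempty) : 0 < ⨆ x, sectionLength A x := by
  obtain ⟨⟨x, y⟩, hp⟩ := h0
  refine lt_of_lt_of_le ?_ (le_ciSup (bddAbove_range_sectionLength hb) x)
  rw [← ENNReal.ofReal_pos, ofReal_sectionLength hb]
  exact (ho.preimage (by fun_prop)).measure_pos _ ⟨y, hp⟩

theorem lintegral_meas_lt_sectionLength_div {A : Set (ℝ × ℝ)} (ho : IsOpen A)
    (hb : Bornology.IsBounded A) {c : ℝ} (hc : 0 < c) :
    ∫⁻ t in Ioi 0, volume {x | t < sectionLength A x / c} = volume A / ENNReal.ofReal c := by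
  rw [← lintegral_eq_lintegral_meas_lt volume
    (.of_forall fun x => div_nonneg (sectionLength_nonneg A x) hc.le)
    ((measurable_sectionLength ho.measurableSet).div_const c).aemeasurable]
  simp_rw [ENNReal.ofReal_div_of_pos hc, ofReal_sectionLength hb, div_eq_mul_inv]
  rw [lintegral_mul_const _ (measurable_measure_prodMk_left ho.measurableSet),
    Measure.volume_eq_prod, Measure.prod_apply ho.measurableSet]

theorem bonnesen {A B : Set (ℝ × ℝ)} (hAo : IsOpen A) (hBo : IsOpen B)
    (hAb : Bornology.IsBounded A) (hBb : Bornology.IsBounded B) (hA0 : A.Nonempty)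
    (hB0 : B.Nonempty) {α β : ℝ} (hα : α = ⨆ x, sectionLength A x)
    (hβ : β = ⨆ x, sectionLength B x) :
    volume A / ENNReal.ofReal α + volume B / ENNReal.ofReal β ≤
      volume (A + B) / ENNReal.ofReal (α + β) := by
  have hα0 : 0 < α := hα ▸ sectionLength_iSup_pos hAo hAb hA0
  have hβ0 : 0 < β := hβ ▸ sectionLength_iSup_pos hBo hBb hB0
  have hSo : IsOpen (A + B) := hAo.add_right
  have hSb : Bornology.IsBounded (A + B) := hAb.add hBb
  have hle : ∀ (C : Set (ℝ × ℝ)) (γ : ℝ), Bornology.IsBounded C → 0 < γ →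
      γ = ⨆ x, sectionLength C x → ∀ t : ℝ, 1 ≤ t → {x | t < sectionLength C x / γ} = ∅ := by
    intro C γ hC hγ hγC t ht
    refine eq_empty_of_forall_notMem fun x hx => ?_
    have h1 : sectionLength C x ≤ γ := hγC ▸ le_ciSup (bddAbove_range_sectionLength hC) x
    rw [mem_ofPred_eq, lt_div_iff₀ hγ] at hx
    nlinarith
  have hne : ∀ (C : Set (ℝ × ℝ)) (γ : ℝ), 0 < γ →
      γ = ⨆ x, sectionLength C x → ∀ t : ℝ, t < 1 → {x | t < sectionLength C x / γ}.Nonempty := by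
    intro C γ hγ hγC t ht
    have : t * γ < ⨆ x, sectionLength C x := by rw [← hγC]; nlinarith
    obtain ⟨x, hx⟩ := exists_lt_of_lt_ciSup this
    exact ⟨x, (lt_div_iff₀ hγ).2 hx⟩
  rw [← lintegral_meas_lt_sectionLength_div hAo hAb hα0,
    ← lintegral_meas_lt_sectionLength_div hBo hBb hβ0,
    ← lintegral_meas_lt_sectionLength_div hSo hSb (add_pos hα0 hβ0)]
  have hmeas : ∀ f : ℝ → ℝ, Measurable fun t : ℝ => volume {x | t < f x} := fun f =>
    Antitone.measurable fun s t hst => measure_mono fun x (hx : t < f x) => hst.trans_lt hx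
  rw [← lintegral_add_left (hmeas _)]
  refine setLIntegral_mono (hmeas _) fun t ht => ?_
  rcases le_or_gt 1 t with h1 | h1
  · simp [hle A α hAb hα0 hα t h1, hle B β hBb hβ0 hβ t h1]
  · refine (volume_add_le_volume_add
      (measurableSet_lt measurable_const
        ((measurable_sectionLength hAo.measurableSet).div_const α))
      (measurableSet_lt measurable_const
        ((measurable_sectionLength hBo.measurableSet).div_const β))
      (hne A α hα0 hα t h1) (hne B β hβ0 hβ t h1)).trans (measure_mono ?_)
    rintro _ ⟨x, hx, y, hy, rfl⟩
    have ht0 : 0 < t := ht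
    simp only [mem_ofPred_eq, lt_div_iff₀ hα0, lt_div_iff₀ hβ0,
      lt_div_iff₀ (add_pos hα0 hβ0)] at hx hy ⊢
    have hx0 : 0 < sectionLength A x := (mul_pos ht0 hα0).trans hx
    have hy0 : 0 < sectionLength B y := (mul_pos ht0 hβ0).trans hy
    have key : sectionLength A x + sectionLength B y ≤ sectionLength (A + B) (x + y) := by
      rw [← ENNReal.ofReal_le_ofReal_iff (sectionLength_nonneg _ _),
        ENNReal.ofReal_add hx0.le hy0.le, ofReal_sectionLength hAb, ofReal_sectionLength hBb,
        ofReal_sectionLength hSb]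
      refine (volume_add_le_volume_add (hAo.preimage (by fun_prop)).measurableSet
        (hBo.preimage (by fun_prop)).measurableSet ?_ ?_).trans (measure_mono ?_)
      · refine nonempty_of_measure_ne_zero (μ := volume) ?_
        rw [← ofReal_sectionLength hAb]
        exact (ENNReal.ofReal_pos.2 hx0).ne'
      · refine nonempty_of_measure_ne_zero (μ := volume) ?_
        rw [← ofReal_sectionLength hBb]
        exact (ENNReal.ofReal_pos.2 hy0).ne'
      · rintro _ ⟨p, hp, q, hq, rfl⟩
        exact ⟨(x, p), hp, (y, q), hq, rfl⟩
    nlinarith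

/-- Planar Brunn–Minkowski inequality for bounded open sets. -/
theorem brunn_minkowski_plane {A B : Set (ℝ × ℝ)} (hAo : IsOpen A) (hBo : IsOpen B)
    (hAb : Bornology.IsBounded A) (hBb : Bornology.IsBounded B) (hA0 : A.Nonempty)
    (hB0 : B.Nonempty) :
    volume.real A + volume.real B + 2 * √(volume.real A * volume.real B) ≤
      volume.real (A + B) := by
  have h := bonnesen hAo hBo hAb hBb hA0 hB0 rfl rfl
  have hα0 := sectionLength_iSup_pos hAo hAb hA0
  have hβ0 := sectionLength_iSup_pos hBo hBb hB0
  set α := ⨆ x, sectionLength A x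
  set β := ⨆ x, sectionLength B x
  have hAf := hAb.measure_lt_top (μ := volume)
  have hBf := hBb.measure_lt_top (μ := volume)
  have hSf := (hAb.add hBb).measure_lt_top (μ := volume)
  have h' : volume.real A / α + volume.real B / β ≤ volume.real (A + B) / (α + β) := by
    have h2 := ENNReal.toReal_mono (ENNReal.div_lt_top hSf.ne
      (ENNReal.ofReal_pos.2 (add_pos hα0 hβ0)).ne').ne h
    rw [ENNReal.toReal_add (ENNReal.div_lt_top hAf.ne (ENNReal.ofReal_pos.2 hα0).ne').ne
      (ENNReal.div_lt_top hBf.ne (ENNReal.ofReal_pos.2 hβ0).ne').ne] at h2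
    simpa only [Measure.real, ENNReal.toReal_div, ENNReal.toReal_ofReal hα0.le, ENNReal.toReal_ofReal hβ0.le,
      ENNReal.toReal_ofReal (add_pos hα0 hβ0).le] using h2
  rw [le_div_iff₀ (add_pos hα0 hβ0)] at h'
  have hx : 0 ≤ volume.real A * (β / α) := by positivity
  have hy : 0 ≤ volume.real B * (α / β) := by positivity
  have hxy : volume.real A * volume.real B =
      (volume.real A * (β / α)) * (volume.real B * (α / β)) := by field_simp
  have hs : 2 * √(volume.real A * volume.real B) ≤
      volume.real A * (β / α) + volume.real B * (α / β) := by
    rw [hxy, Real.sqrt_mul hx]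
    nlinarith [Real.sq_sqrt hx, Real.sq_sqrt hy,
      sq_nonneg (√(volume.real A * (β / α)) - √(volume.real B * (α / β)))]
  have he : (volume.real A / α + volume.real B / β) * (α + β) = volume.real A + volume.real B +
      (volume.real A * (β / α) + volume.real B * (α / β)) := by field_simp; ring
  linarith

/-- The linear identification of the plane with `ℝ × ℝ`, with the periodic coordinate first. -/
def ptProd : Pt ≃L[ℝ] ℝ × ℝ :=
  ((EuclideanSpace.equiv (Fin 2) ℝ).trans (ContinuousLinearEquiv.finTwoArrow ℝ ℝ)).trans
    (ContinuousLinearEquiv.prodComm ℝ ℝ ℝ)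

theorem ptProd_apply (x : Pt) : ptProd x = (x 1, x 0) := rfl

theorem measurePreserving_ptProd : MeasurePreserving ptProd :=
  Measure.measurePreserving_swap.comp
    ((volume_preserving_finTwoArrow ℝ).comp (PiLp.volume_preserving_ofLp (Fin 2)))

theorem volume_preimage_ptProd_symm (E : Set Pt) : volume (ptProd.symm ⁻¹' E) = volume E := by
  have h : MeasurePreserving ptProd.toHomeomorph.toMeasurableEquiv := measurePreserving_ptProd
  rw [← h.measure_preimage_equiv]
  congr 1
  ext x
  simp

theorem measurable_coord (i : Fin 2) : Measurable fun x : Pt => x i :=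
  (EuclideanSpace.proj (𝕜 := ℝ) i).continuous.measurable

theorem abs_coord_sub_le (x y : Pt) (i : Fin 2) : |x i - y i| ≤ dist x y := by
  rw [dist_eq_norm, ← Real.norm_eq_abs, ← PiLp.sub_apply]
  exact PiLp.norm_apply_le (x - y) i

/-- The planar isoperimetric inequality, in terms of the area of a tubular neighbourhood. -/
theorem volume_add_le_volume_thickening {E : Set Pt} (hEo : IsOpen E)
    (hEb : Bornology.IsBounded E) {ε : ℝ} (hε : 0 < ε) :
    volume E + ENNReal.ofReal (2 * ε * √(Real.pi * (volume E).toReal)) ≤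
      volume (thickening ε E) := by
  rcases E.eq_empty_or_nonempty with rfl | hE0
  · simp
  have hsym : ∀ A : Set Pt, Bornology.IsBounded A → Bornology.IsBounded (ptProd.symm ⁻¹' A) := by
    intro A hA
    rw [← ContinuousLinearEquiv.image_eq_preimage_symm]
    exact ptProd.lipschitz.isBounded_image hA
  have hball : volume.real (ptProd.symm ⁻¹' ball (0 : Pt) ε) = Real.pi * ε ^ 2 := by
    rw [Measure.real, volume_preimage_ptProd_symm, EuclideanSpace.volume_ball_fin_two]
    simp [hε.le, Real.pi_pos.le, mul_comm]
  have h := brunn_minkowski_plane (hEo.preimage ptProd.symm.continuous)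
    ((isOpen_ball (x := (0 : Pt)) (ε := ε)).preimage ptProd.symm.continuous) (hsym E hEb)
    (hsym _ isBounded_ball) (hE0.preimage ptProd.symm.surjective)
    ((nonempty_ball.2 hε).preimage ptProd.symm.surjective)
  rw [hball] at h
  have hsub : ptProd.symm ⁻¹' E + ptProd.symm ⁻¹' ball (0 : Pt) ε =
      ptProd.symm ⁻¹' (thickening ε E) := by
    rw [← add_ball_zero, ← ContinuousLinearEquiv.image_eq_preimage_symm,
      ← ContinuousLinearEquiv.image_eq_preimage_symm,
      ← ContinuousLinearEquiv.image_eq_preimage_symm, image_add]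
  rw [hsub] at h
  simp only [Measure.real, volume_preimage_ptProd_symm] at h
  have hEf := hEb.measure_lt_top (μ := volume)
  have hTf := hEb.thickening (δ := ε) |>.measure_lt_top (μ := volume)
  rw [← ENNReal.ofReal_toReal hEf.ne, ← ENNReal.ofReal_toReal hTf.ne,
    ENNReal.toReal_ofReal ENNReal.toReal_nonneg,
    ← ENNReal.ofReal_add ENNReal.toReal_nonneg (by positivity)]
  refine ENNReal.ofReal_le_ofReal (le_trans ?_ h)
  have : √((volume E).toReal * (Real.pi * ε ^ 2)) = ε * √(Real.pi * (volume E).toReal) := by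
    rw [show (volume E).toReal * (Real.pi * ε ^ 2) = ε ^ 2 * (Real.pi * (volume E).toReal) by ring,
      Real.sqrt_mul (by positivity), Real.sqrt_sq hε.le]
  rw [this]
  have := mul_pos Real.pi_pos (sq_pos_of_pos hε)
  linarith

/-- The axial section of a planar set at height `t`. -/
def axialSection (E : Set Pt) (t : ℝ) : Set ℝ := {s | ptProd.symm (t, s) ∈ E}

theorem isOpen_axialSection {E : Set Pt} (hE : IsOpen E) (t : ℝ) : IsOpen (axialSection E t) :=
  hE.preimage (ptProd.symm.continuous.comp (by fun_prop))

theorem measurableSet_strip {I : Set ℝ} (hI : MeasurableSet I) :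
    MeasurableSet {x : Pt | x 1 ∈ I} :=
  hI.preimage (measurable_coord 1)

theorem volume_inter_strip {E : Set Pt} (hE : MeasurableSet E) {I : Set ℝ}
    (hI : MeasurableSet I) :
    volume (E ∩ {x : Pt | x 1 ∈ I}) = ∫⁻ t in I, volume (axialSection E t) := by
  rw [← volume_preimage_ptProd_symm, Measure.volume_eq_prod,
    Measure.prod_apply ((hE.inter (measurableSet_strip hI)).preimage
      ptProd.symm.continuous.measurable), ← lintegral_indicator hI]
  refine lintegral_congr fun t => ?_
  have hc : ∀ s : ℝ, (ptProd.symm (t, s)) 1 = t := fun s =>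
    congrArg Prod.fst (ptProd.apply_symm_apply (t, s))
  by_cases ht : t ∈ I
  · rw [indicator_of_mem ht]
    congr 1
    ext s
    simp [axialSection, hc, ht]
  · rw [indicator_of_notMem ht, ← measure_empty (μ := (volume : Measure ℝ))]
    congr 1
    ext s
    simp [hc, ht]

theorem measurableSet_cylFund (P : ℝ) : MeasurableSet (cylFund P) :=
  measurableSet_strip measurableSet_Ico

/-- The area of a periodic set in a strip of width one period does not depend on the strip. -/
theorem volume_inter_cylFund_eq {P : ℝ} (hP : 0 < P) {E : Set Pt} (hE : MeasurableSet E)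
    (hper : IsPeriodicSet P E) (a : ℝ) :
    volume (E ∩ cylFund P) = volume (E ∩ {x : Pt | x 1 ∈ Ioo a (a + P)}) := by
  have hs : Function.Periodic (fun t => volume (axialSection E t)) P := by
    intro t
    change volume (axialSection E (t + P)) = volume (axialSection E t)
    congr 1
    ext s
    have : ptProd.symm (t + P, s) = ptProd.symm (t, s) + cylShift P := by
      rw [ptProd.symm_apply_eq, map_add, ptProd.apply_symm_apply, ptProd_apply]
      simp [cylShift]
    simp only [axialSection, mem_ofPred_eq, this]
    exact (hper _).symm
  rw [cylFund, volume_inter_strip hE measurableSet_Ico, volume_inter_strip hE measurableSet_Ioo,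
    setLIntegral_congr Ioo_ae_eq_Ioc, setLIntegral_congr Ico_ae_eq_Ioc]
  have h0 := isAddFundamentalDomain_Ioc hP 0
  rw [zero_add] at h0
  refine h0.setLIntegral_eq (isAddFundamentalDomain_Ioc hP a) _ ?_
  rintro ⟨_, n, rfl⟩ t
  change volume (axialSection E (n • P + t)) = _
  rw [add_comm]
  exact hs.zsmul n t

/-- Tubular neighbourhoods of a cylindrical set meeting every axial line. -/
theorem volume_thickening_inter_cylFund_of_full {P : ℝ} {E : Set Pt} (hEo : IsOpen E)
    (hfull : ∀ t, ∃ x ∈ E, x 1 = t) {ε : ℝ} (hε : 0 < ε) :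
    volume (E ∩ cylFund P) + ENNReal.ofReal (2 * ε * P) ≤
      volume (thickening ε E ∩ cylFund P) := by
  rw [cylFund, volume_inter_strip hEo.measurableSet measurableSet_Ico,
    volume_inter_strip isOpen_thickening.measurableSet measurableSet_Ico]
  have hc : ENNReal.ofReal (2 * ε * P) = ∫⁻ _ in Ico 0 P, ENNReal.ofReal (2 * ε) := by
    rw [setLIntegral_const, Real.volume_Ico, sub_zero, ENNReal.ofReal_mul (by positivity)]
  rw [hc, ← lintegral_add_right _ measurable_const]
  refine lintegral_mono fun t => ?_
  obtain ⟨x, hx, hxt⟩ := hfull t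
  have hne : (axialSection E t).Nonempty := by
    refine ⟨x 0, ?_⟩
    rw [axialSection, mem_ofPred_eq, ← hxt, ← ptProd_apply, ptProd.symm_apply_apply]
    exact hx
  have h := volume_add_le_volume_add (isOpen_axialSection hEo t).measurableSet
    (measurableSet_ball (x := (0 : ℝ)) (ε := ε)) hne (nonempty_ball.2 hε)
  rw [Real.volume_ball] at h
  refine h.trans (measure_mono ?_)
  rintro _ ⟨s, hs, r, hr, rfl⟩
  refine mem_thickening_iff.2 ⟨_, hs, ?_⟩
  rw [mem_ball_zero_iff] at hr
  rw [dist_eq_norm, ← map_sub]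
  have : ptProd.symm ((t, s + r) - (t, s)) = EuclideanSpace.single (0 : Fin 2) r := by
    rw [ptProd.symm_apply_eq, ptProd_apply]
    simp
  rw [this]
  simpa using hr

/-- Tubular neighbourhoods of a cylindrical set staying away from an axial line. -/
theorem volume_thickening_inter_cylFund_of_gap {P : ℝ} (hP : 0 < P) {E : Set Pt} (hEo : IsOpen E)
    (hper : IsPeriodicSet P E) {R : ℝ} (hR : ∀ x ∈ E, |x 0| ≤ R) {a δ : ℝ}
    (hgap : ∀ x ∈ E, ∀ y : Pt, y 1 = a ∨ y 1 = a + P → δ ≤ dist x y) {ε : ℝ}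
    (hε : 0 < ε) (hεδ : ε ≤ δ) :
    volume (E ∩ cylFund P) +
        ENNReal.ofReal (2 * ε * √(Real.pi * (volume (E ∩ cylFund P)).toReal)) ≤
      volume (thickening ε E ∩ cylFund P) := by
  have hperT : IsPeriodicSet P (thickening ε E) := by
    intro x
    simp only [mem_thickening_iff]
    constructor
    · rintro ⟨z, hz, hd⟩
      exact ⟨z + cylShift P, (hper z).1 hz, by simpa using hd⟩
    · rintro ⟨z, hz, hd⟩
      refine ⟨z - cylShift P, (hper _).2 (by simpa using hz), ?_⟩
      rwa [← dist_add_right _ _ (cylShift P), sub_add_cancel]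
  rw [volume_inter_cylFund_eq hP hEo.measurableSet hper a,
    volume_inter_cylFund_eq hP isOpen_thickening.measurableSet hperT a]
  have hline : ∀ x ∈ E, ∀ b, b = a ∨ b = a + P → δ ≤ |x 1 - b| := by
    intro x hx b hb
    refine (hgap x hx (x + EuclideanSpace.single (1 : Fin 2) (b - x 1)) (by simpa using hb)).trans
      (le_of_eq ?_)
    rw [dist_eq_norm, sub_add_cancel_left, norm_neg, PiLp.norm_single, Real.norm_eq_abs,
      abs_sub_comm]
  refine (volume_add_le_volume_thickening (ε := ε) ?_ ?_ hε).trans (measure_mono ?_)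
  · exact hEo.inter (isOpen_Ioo.preimage (EuclideanSpace.proj (𝕜 := ℝ) (1 : Fin 2)).continuous)
  · refine (isBounded_iff_forall_norm_le.2 ⟨R + (|a| + |a + P|), ?_⟩)
    rintro x ⟨hx, hx1⟩
    have h0 := hR x hx
    have h1 : |x 1| ≤ |a| + |a + P| := by
      rw [abs_le]
      have := hx1.1
      have := hx1.2
      constructor
      · linarith [neg_abs_le a, abs_nonneg (a + P)]
      · linarith [le_abs_self (a + P), abs_nonneg a]
    rw [EuclideanSpace.norm_eq, Fin.sum_univ_two]
    refine (Real.sqrt_le_sqrt (y := (|x 0| + |x 1|) ^ 2) ?_).trans ?_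
    · simp only [Real.norm_eq_abs]
      nlinarith [abs_nonneg (x 0), abs_nonneg (x 1)]
    · rw [Real.sqrt_sq (by positivity)]
      linarith
  · intro x hx
    obtain ⟨z, ⟨hz, hz1⟩, hd⟩ := mem_thickening_iff.1 hx
    refine ⟨mem_thickening_iff.2 ⟨z, hz, hd⟩, ?_⟩
    have h1 := (abs_coord_sub_le x z 1).trans_lt hd
    have h2 := hline z hz a (.inl rfl)
    have h3 := hline z hz (a + P) (.inr rfl)
    rw [abs_of_pos (sub_pos.2 hz1.1)] at h2
    rw [abs_of_neg (sub_neg.2 hz1.2)] at h3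
    rw [abs_lt] at h1
    exact ⟨by linarith, by linarith⟩

/-- A `C¹` function on the cylinder which vanishes far out along the axis. -/
structure IsCylTest (P R : ℝ) (u : Pt → ℝ) : Prop where
  contDiff : ContDiff ℝ 1 u
  periodic : IsPeriodicFun P u
  support : ∀ x, u x ≠ 0 → |x 0| ≤ R

/-- The area of a superlevel set on the cylinder. -/
def cylLevelArea (P : ℝ) (u : Pt → ℝ) (s : ℝ) : ℝ≥0∞ := volume ({x | s < u x} ∩ cylFund P)

/-- The lower bound for the isoperimetric profile of the cylinder. -/
def cylProfile (P a : ℝ) : ℝ := min (2 * P) (2 * √(Real.pi * a))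

theorem isBounded_of_coord_le {S : Set Pt} {a b : ℝ} (h : ∀ x ∈ S, |x 0| ≤ a ∧ |x 1| ≤ b) :
    Bornology.IsBounded S := by
  refine isBounded_iff_forall_norm_le.2 ⟨a + b, fun x hx => ?_⟩
  obtain ⟨h0, h1⟩ := h x hx
  rw [EuclideanSpace.norm_eq, Fin.sum_univ_two]
  refine (Real.sqrt_le_sqrt (y := (|x 0| + |x 1|) ^ 2) ?_).trans ?_
  · simp only [Real.norm_eq_abs]
    nlinarith [abs_nonneg (x 0), abs_nonneg (x 1)]
  · rw [Real.sqrt_sq (by positivity)]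
    linarith

theorem isBounded_axial_inter_cylFund (P R : ℝ) :
    Bornology.IsBounded ({x : Pt | |x 0| ≤ R} ∩ cylFund P) := by
  refine isBounded_of_coord_le (a := R) (b := P) ?_
  rintro x ⟨h0, h1⟩
  exact ⟨h0, abs_le.2 ⟨by linarith [h1.1, h1.2], h1.2.le⟩⟩

theorem exists_sub_zsmul_mem_cylFund {P : ℝ} (hP : 0 < P) (x : Pt) :
    ∃ n : ℤ, x - n • cylShift P ∈ cylFund P := by
  obtain ⟨n, hn, -⟩ := existsUnique_sub_zsmul_mem_Ico hP (x 1) 0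
  refine ⟨n, ?_⟩
  rw [zero_add] at hn
  simpa [cylFund, cylShift] using hn

namespace IsCylTest

variable {P R : ℝ} {u : Pt → ℝ}

theorem fderiv_periodic (h : IsCylTest P R u) : Function.Periodic (fderiv ℝ u) (cylShift P) := by
  intro x
  rw [← fderiv_comp_add_right]
  congr 1
  exact funext h.periodic

theorem isClosed_axial (R : ℝ) : IsClosed {x : Pt | |x 0| ≤ R} :=
  isClosed_le (EuclideanSpace.proj (𝕜 := ℝ) (0 : Fin 2)).continuous.abs continuous_const

theorem fderiv_eq_zero (h : IsCylTest P R u) {x : Pt} (hx : ¬ |x 0| ≤ R) : fderiv ℝ u x = 0 := by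
  have : u =ᶠ[𝓝 x] fun _ => 0 := by
    filter_upwards [(isClosed_axial R).isOpen_compl.mem_nhds hx] with y hy
    by_contra hne
    exact hy (h.support y hne)
  rw [this.fderiv_eq, fderiv_fun_const, Pi.zero_apply]

theorem exists_fderiv_le (hP : 0 < P) (h : IsCylTest P R u) :
    ∃ L : ℝ≥0, 0 < L ∧ ∀ x, ‖fderiv ℝ u x‖₊ ≤ L := by
  have hc : IsCompact (closure ({x : Pt | |x 0| ≤ R} ∩ cylFund P)) :=
    (isBounded_axial_inter_cylFund P R).isCompact_closure
  obtain ⟨C, hC⟩ := hc.exists_bound_of_continuousOn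
    (h.contDiff.continuous_fderiv one_ne_zero).continuousOn
  refine ⟨Real.toNNReal (max C 1), by simp, fun x => ?_⟩
  rw [← NNReal.coe_le_coe, coe_nnnorm, Real.coe_toNNReal _ (by positivity)]
  obtain ⟨n, hn⟩ := exists_sub_zsmul_mem_cylFund hP x
  rw [← h.fderiv_periodic.sub_zsmul_eq n]
  by_cases hx : |(x - n • cylShift P) 0| ≤ R
  · exact (hC _ (subset_closure ⟨hx, hn⟩)).trans (le_max_left _ _)
  · rw [h.fderiv_eq_zero hx, norm_zero]
    positivity

theorem lipschitz (h : IsCylTest P R u) {L : ℝ≥0} (hL : ∀ x, ‖fderiv ℝ u x‖₊ ≤ L) :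
    LipschitzWith L u :=
  lipschitzWith_of_nnnorm_fderiv_le (h.contDiff.differentiable one_ne_zero) hL

theorem isOpen_superlevel (h : IsCylTest P R u) (s : ℝ) : IsOpen {x | s < u x} :=
  isOpen_lt continuous_const h.contDiff.continuous

theorem isPeriodicSet_superlevel (h : IsCylTest P R u) (s : ℝ) :
    IsPeriodicSet P {x | s < u x} := fun x => by
  simp only [mem_ofPred_eq, h.periodic x]

theorem levelArea_lt_top (h : IsCylTest P R u) {s : ℝ} (hs : 0 ≤ s) :
    cylLevelArea P u s < ∞ := by
  refine ((isBounded_axial_inter_cylFund P R).subset ?_).measure_lt_top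
  exact inter_subset_inter_left _ fun x hx => h.support x (hs.trans_lt hx).ne'

theorem measurable_levelArea : Measurable (cylLevelArea P u) :=
  Antitone.measurable fun _ _ hst => measure_mono <|
    inter_subset_inter_left _ fun _ hx => hst.trans_lt hx

/-- For all but one level, small tubular neighbourhoods of the superlevel set have area at
least as large as the isoperimetric profile predicts. -/
theorem levelArea_add_le (hP : 0 < P) (h : IsCylTest P R u) :
    ∃ B : Set ℝ, B.Subsingleton ∧ ∀ s, 0 < s → s ∉ B → ∀ᶠ ε in 𝓝[>] (0 : ℝ),
      cylLevelArea P u s + ENNReal.ofReal (ε * cylProfile P (cylLevelArea P u s).toReal) ≤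
        volume (thickening ε {x | s < u x} ∩ cylFund P) := by
  obtain ⟨L, hL0, hL⟩ := h.exists_fderiv_le hP
  have hlip := h.lipschitz hL
  set S : Set ℝ := {s | ∀ t, ∃ x ∈ {x | s < u x}, x 1 = t}
  refine ⟨{s | s ∉ S ∧ ∀ r < s, r ∈ S}, ?_, ?_⟩
  · rintro s ⟨hs, hs'⟩ r ⟨hr, hr'⟩
    rcases lt_trichotomy s r with hlt | rfl | hlt
    · exact absurd (hr' s hlt) hs
    · rfl
    · exact absurd (hs' r hlt) hr
  intro s hs0 hsB
  by_cases hs : s ∈ S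
  · filter_upwards [self_mem_nhdsWithin] with ε hε
    have hε : 0 < ε := hε
    refine le_trans ?_ (volume_thickening_inter_cylFund_of_full (P := P)
      (h.isOpen_superlevel s) hs hε)
    refine add_le_add le_rfl (ENNReal.ofReal_le_ofReal ?_)
    have := min_le_left (2 * P) (2 * √(Real.pi * (cylLevelArea P u s).toReal))
    rw [cylProfile]
    nlinarith
  · obtain ⟨r, hr, hrS⟩ : ∃ r < s, r ∉ S := by
      by_contra! hcon
      exact hsB ⟨hs, hcon⟩
    obtain ⟨a, ha⟩ : ∃ a, ∀ x : Pt, x 1 = a → u x ≤ r := by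
      by_contra! hcon
      exact hrS fun t => by
        obtain ⟨x, hx, hx'⟩ := hcon t
        exact ⟨x, hx', hx⟩
    have hL0' : (0 : ℝ) < L := hL0
    have hδ : 0 < (s - r) / L := div_pos (sub_pos.2 hr) hL0'
    filter_upwards [Ioc_mem_nhdsGT hδ] with ε hε
    refine le_trans ?_ (volume_thickening_inter_cylFund_of_gap hP (h.isOpen_superlevel s)
      (h.isPeriodicSet_superlevel s) (R := R) (fun x hx => h.support x (hs0.trans hx).ne')
      (a := a) (δ := (s - r) / L) ?_ hε.1 hε.2)
    · refine add_le_add le_rfl (ENNReal.ofReal_le_ofReal ?_)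
      have := min_le_right (2 * P) (2 * √(Real.pi * (cylLevelArea P u s).toReal))
      rw [cylProfile]
      change _ ≤ 2 * ε * √(Real.pi * (cylLevelArea P u s).toReal)
      nlinarith [hε.1]
    · intro x hx y hy
      have hyr : u y ≤ r := by
        rcases hy with hy | hy
        · exact ha y hy
        · rw [← sub_add_cancel y (cylShift P), h.periodic]
          exact ha _ (by simp [cylShift, hy])
      rw [div_le_iff₀ hL0', mul_comm]
      have h1 := hlip.dist_le_mul x y
      rw [Real.dist_eq] at h1
      have h2 : s < u x := hx
      linarith [le_abs_self (u x - u y)]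

/-- The pairs `(x, s)` with `s ∈ F` such that the level `s` is crossed within distance `ε`
above `x`. -/
def crossing (u : Pt → ℝ) (F : Set ℝ) (ε : ℝ) : Set (Pt × ℝ) :=
  {p | p.2 ∈ F ∧ u p.1 ≤ p.2 ∧ ∃ y, dist p.1 y < ε ∧ p.2 < u y}

theorem measurableSet_crossing (hu : Continuous u) {F : Set ℝ} (hF : IsClosed F) (ε : ℝ) :
    MeasurableSet (crossing u F ε) := by
  refine (hF.preimage continuous_snd).measurableSet.inter (MeasurableSet.inter
    (isClosed_le (hu.comp continuous_fst) continuous_snd).measurableSet (IsOpen.measurableSet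
      (s := {p : Pt × ℝ | ∃ y, dist p.1 y < ε ∧ p.2 < u y}) ?_))
  have : {p : Pt × ℝ | ∃ y, dist p.1 y < ε ∧ p.2 < u y} =
      ⋃ y, {p : Pt × ℝ | dist p.1 y < ε ∧ p.2 < u y} := by
    ext; simp
  rw [this]
  refine isOpen_iUnion fun y => ?_
  have h1 : IsOpen {p : Pt × ℝ | dist p.1 y < ε} :=
    isOpen_lt (continuous_fst.dist continuous_const) continuous_const
  exact h1.inter (isOpen_lt continuous_snd continuous_const)

theorem volume_crossing_le {F : Set ℝ} {ε : ℝ} (x : Pt) {C : ℝ}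
    (hC : ∀ y, dist x y < ε → u y ≤ u x + C) :
    volume (Prod.mk x ⁻¹' crossing u F ε) ≤ ENNReal.ofReal C := by
  rw [← add_sub_cancel_left (u x) C, ← Real.volume_Ico]
  refine measure_mono ?_
  rintro s ⟨-, h1, y, hy, h2⟩
  exact ⟨h1, lt_of_lt_of_le h2 (hC y hy)⟩

theorem limsup_crossing_le (h : IsCylTest P R u) {L : ℝ≥0} (hL : ∀ x, ‖fderiv ℝ u x‖₊ ≤ L)
    {F : Set ℝ} (hF : IsClosed F) (x : Pt) :
    limsup (fun n : ℕ => ENNReal.ofReal (n + 1) *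
        volume (Prod.mk x ⁻¹' crossing u F (1 / (n + 1)))) atTop ≤
      (u ⁻¹' F).indicator (fun x => ‖fderiv ℝ u x‖ₑ) x := by
  have hlim : Tendsto (fun n : ℕ => 1 / ((n : ℝ) + 1)) atTop (𝓝 0) :=
    tendsto_one_div_add_atTop_nhds_zero_nat
  have hpos : ∀ n : ℕ, (0 : ℝ) < n + 1 := fun n => by positivity
  by_cases hx : u x ∈ F
  · rw [indicator_of_mem (by exact hx)]
    refine ENNReal.le_of_forall_pos_le_add fun η hη _ => ?_
    refine limsup_le_of_le (by isBoundedDefault) ?_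
    have hd := (h.contDiff.differentiable one_ne_zero x).hasFDerivAt.isLittleO.def
      (c := η) hη
    obtain ⟨δ, hδ, hd⟩ := Metric.eventually_nhds_iff.1 hd
    filter_upwards [hlim.eventually_lt_const hδ] with n hn
    have hle : volume (Prod.mk x ⁻¹' crossing u F (1 / (n + 1))) ≤
        ENNReal.ofReal ((‖fderiv ℝ u x‖ + η) * (1 / (n + 1))) := by
      refine volume_crossing_le x fun y hy => ?_
      have hy' : dist y x < 1 / (n + 1) := by rwa [dist_comm]
      have h1 := hd (hy'.trans hn)
      have h2 := (fderiv ℝ u x).le_opNorm (y - x)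
      have h3 := le_abs_self (u y - u x - (fderiv ℝ u x) (y - x))
      have h4 := le_abs_self ((fderiv ℝ u x) (y - x))
      rw [Real.norm_eq_abs] at h1 h2
      rw [dist_eq_norm] at hy'
      have h5 : (‖fderiv ℝ u x‖ + η) * ‖y - x‖ ≤ (‖fderiv ℝ u x‖ + η) * (1 / (n + 1)) := by
        gcongr
      linarith
    calc _ ≤ ENNReal.ofReal (n + 1) * ENNReal.ofReal ((‖fderiv ℝ u x‖ + η) * (1 / (n + 1))) := by
          gcongr
      _ = ENNReal.ofReal (‖fderiv ℝ u x‖ + η) := by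
          rw [← ENNReal.ofReal_mul (hpos n).le]
          congr 1
          field_simp
      _ = ‖fderiv ℝ u x‖ₑ + η := by
          rw [ENNReal.ofReal_add (norm_nonneg _) η.coe_nonneg, ofReal_norm,
            ENNReal.ofReal_coe_nnreal]
  · rw [indicator_of_notMem (by exact hx), nonpos_iff_eq_zero]
    refine (limsup_congr ?_).trans (limsup_const 0)
    obtain ⟨δ, hδ, hd⟩ := Metric.isOpen_iff.1 hF.isOpen_compl (u x) hx
    have hlim' : Tendsto (fun n : ℕ => L * (1 / ((n : ℝ) + 1))) atTop (𝓝 0) := by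
      simpa using hlim.const_mul (L : ℝ)
    filter_upwards [hlim'.eventually_lt_const hδ] with n hn
    have : Prod.mk x ⁻¹' crossing u F (1 / (n + 1)) = ∅ := by
      refine eq_empty_of_forall_notMem ?_
      rintro s ⟨hs, h1, y, hy, h2⟩
      refine hd ?_ hs
      have h3 := (h.lipschitz hL).dist_le_mul y x
      rw [Real.dist_eq, dist_comm] at h3
      have h4 : L * dist x y ≤ L * (1 / ((n : ℝ) + 1)) := by
        gcongr
      rw [mem_ball, Real.dist_eq, abs_of_nonneg (sub_nonneg.2 h1)]
      dsimp only at h2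
      linarith [le_abs_self (u y - u x)]
    rw [this, measure_empty, mul_zero]

theorem lintegral_profile_le_of_isClosed (hP : 0 < P) (h : IsCylTest P R u) (h0 : ∀ x, 0 ≤ u x)
    {F : Set ℝ} (hF : IsClosed F) :
    ∫⁻ s in F ∩ Ioi 0, ENNReal.ofReal (cylProfile P (cylLevelArea P u s).toReal) ≤
      ∫⁻ x in cylFund P, (u ⁻¹' F).indicator (fun x => ‖fderiv ℝ u x‖ₑ) x := by
  obtain ⟨L, hL0, hL⟩ := h.exists_fderiv_le hP
  obtain ⟨B, hB, hlev⟩ := h.levelArea_add_le hP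
  have hpos : ∀ n : ℕ, (0 : ℝ) < n + 1 := fun n => by positivity
  have hmeas : ∀ n : ℕ, MeasurableSet (crossing u F (1 / ((n : ℝ) + 1))) := fun n =>
    measurableSet_crossing h.contDiff.continuous hF _
  have hfub : ∀ n : ℕ, ∫⁻ x in cylFund P, ENNReal.ofReal (n + 1) *
      volume (Prod.mk x ⁻¹' crossing u F (1 / (n + 1))) =
      ∫⁻ s, ENNReal.ofReal (n + 1) * volume.restrict (cylFund P)
        ((fun x => (x, s)) ⁻¹' crossing u F (1 / (n + 1))) := by
    intro n
    rw [lintegral_const_mul _ (measurable_measure_prodMk_left (hmeas n)),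
      lintegral_const_mul _ (measurable_measure_prodMk_right (hmeas n)),
      ← Measure.prod_apply (hmeas n), ← Measure.prod_apply_symm (hmeas n)]
  have hupper : limsup (fun n : ℕ => ∫⁻ x in cylFund P, ENNReal.ofReal (n + 1) *
      volume (Prod.mk x ⁻¹' crossing u F (1 / (n + 1)))) atTop ≤
      ∫⁻ x in cylFund P, (u ⁻¹' F).indicator (fun x => ‖fderiv ℝ u x‖ₑ) x := by
    refine (limsup_lintegral_le ({x : Pt | |x 0| ≤ R + 1}.indicator fun _ => (L : ℝ≥0∞))
      (fun n => (measurable_measure_prodMk_left (hmeas n)).const_mul _)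
      (fun n => .of_forall fun x => ?_) ?_).trans
      (lintegral_mono fun x => h.limsup_crossing_le hL hF x)
    · by_cases hx : |x 0| ≤ R + 1
      · rw [indicator_of_mem (by exact hx)]
        have hle : volume (Prod.mk x ⁻¹' crossing u F (1 / (n + 1))) ≤
            ENNReal.ofReal (L * (1 / (n + 1))) := by
          refine volume_crossing_le x fun y hy => ?_
          have h3 := (h.lipschitz hL).dist_le_mul y x
          rw [Real.dist_eq, dist_comm] at h3
          have h4 : L * dist x y ≤ L * (1 / ((n : ℝ) + 1)) := by
            gcongr
          linarith [le_abs_self (u y - u x)]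
        calc _ ≤ ENNReal.ofReal (n + 1) * ENNReal.ofReal (L * (1 / (n + 1))) := mul_le_mul_right hle _
          _ = L := by
            rw [← ENNReal.ofReal_mul (hpos n).le, ← ENNReal.ofReal_coe_nnreal]
            congr 1
            field_simp
      · rw [indicator_of_notMem (by exact hx)]
        have : Prod.mk x ⁻¹' crossing u F (1 / (n + 1)) = ∅ := by
          refine eq_empty_of_forall_notMem ?_
          rintro s ⟨-, h1, y, hy, h2⟩
          refine hx ?_
          have hy0 : u y ≠ 0 := ((h0 x).trans_lt (lt_of_le_of_lt h1 h2)).ne'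
          have h3 := h.support y hy0
          have h4 := abs_coord_sub_le x y 0
          have h5 : 1 / ((n : ℝ) + 1) ≤ 1 := by
            rw [div_le_one (hpos n)]
            linarith [(Nat.cast_nonneg n : (0 : ℝ) ≤ n)]
          have h6 := abs_sub_abs_le_abs_sub (x 0) (y 0)
          dsimp only at hy
          linarith
        simp only [this, measure_empty, mul_zero]
        exact le_rfl
    · rw [lintegral_indicator_const (isClosed_axial _).measurableSet,
        Measure.restrict_apply (isClosed_axial _).measurableSet]
      exact ENNReal.mul_ne_top ENNReal.coe_ne_top
        (isBounded_axial_inter_cylFund P (R + 1)).measure_lt_top.ne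
  refine le_trans ?_ hupper
  refine le_trans ?_ (liminf_le_limsup (by isBoundedDefault) (by isBoundedDefault))
  simp_rw [hfub]
  refine le_trans ?_ (lintegral_liminf_le fun n =>
    (measurable_measure_prodMk_right (hmeas n)).const_mul _)
  rw [← lintegral_indicator (hF.measurableSet.inter measurableSet_Ioi)]
  refine lintegral_mono_ae ?_
  filter_upwards [hB.countable.ae_notMem volume] with s hs
  by_cases hsF : s ∈ F ∩ Ioi 0
  swap
  · rw [indicator_of_notMem hsF]; exact zero_le
  rw [indicator_of_mem hsF]
  have hs0 : 0 < s := hsF.2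
  refine le_liminf_of_le (by isBoundedDefault) ?_
  have hlim : Tendsto (fun n : ℕ => 1 / ((n : ℝ) + 1)) atTop (𝓝[>] 0) :=
    tendsto_nhdsWithin_iff.2 ⟨tendsto_one_div_add_atTop_nhds_zero_nat,
      .of_forall fun n => one_div_pos.2 (hpos n)⟩
  filter_upwards [hlim.eventually (hlev s hs0 hs)] with n hn
  have hset : (fun x => (x, s)) ⁻¹' crossing u F (1 / ((n : ℝ) + 1)) =
      thickening (1 / ((n : ℝ) + 1)) {x | s < u x} \ {x | s < u x} := by
    ext x
    simp only [crossing, mem_preimage, mem_ofPred_eq, Set.mem_sdiff, mem_thickening_iff, not_lt]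
    constructor
    · rintro ⟨-, h1, y, hy, h2⟩
      exact ⟨⟨y, h2, hy⟩, h1⟩
    · rintro ⟨⟨y, h2, hy⟩, h1⟩
      exact ⟨hsF.1, h1, y, hy, h2⟩
  have hK := measurableSet_cylFund P
  rw [hset, measure_sdiff (self_subset_thickening (one_div_pos.2 (hpos n)) _)
    (h.isOpen_superlevel s).measurableSet.nullMeasurableSet,
    Measure.restrict_apply' hK, Measure.restrict_apply' hK]
  · calc ENNReal.ofReal (cylProfile P (cylLevelArea P u s).toReal)
        = ENNReal.ofReal (n + 1) *
          ENNReal.ofReal (1 / (n + 1) * cylProfile P (cylLevelArea P u s).toReal) := by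
          rw [← ENNReal.ofReal_mul (hpos n).le]
          congr 1
          field_simp
      _ ≤ _ := by
          gcongr
          exact ENNReal.le_sub_of_add_le_left (h.levelArea_lt_top hs0.le).ne hn
  · rw [Measure.restrict_apply' hK]
    exact (h.levelArea_lt_top hs0.le).ne

/-- Coarea-type inequality combined with the isoperimetric inequality on the cylinder. -/
theorem lintegral_mul_profile_le (hP : 0 < P) (h : IsCylTest P R u) (h0 : ∀ x, 0 ≤ u x)
    {ψ : ℝ → ℝ≥0∞} (hψ : Measurable ψ) :
    ∫⁻ s in Ioi 0, ψ s * ENNReal.ofReal (cylProfile P (cylLevelArea P u s).toReal) ≤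
      ∫⁻ x in cylFund P, ψ (u x) * ‖fderiv ℝ u x‖ₑ := by
  have hmu : Measurable u := h.contDiff.continuous.measurable
  have hmd : Measurable fun x => ‖fderiv ℝ u x‖ₑ :=
    (h.contDiff.continuous_fderiv one_ne_zero).measurable.enorm
  have hmp : Measurable fun s =>
      ENNReal.ofReal (cylProfile P (cylLevelArea P u s).toReal) := by
    have := (measurable_levelArea (P := P) (u := u)).ennreal_toReal
    unfold cylProfile
    fun_prop
  set ν₁ := (((volume.restrict (cylFund P)).withDensity fun x => ‖fderiv ℝ u x‖ₑ)).map u with hν₁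
  set ν₂ := (volume.restrict (Ioi (0 : ℝ))).withDensity fun s =>
      ENNReal.ofReal (cylProfile P (cylLevelArea P u s).toReal) with hν₂
  have hcl : ∀ F, IsClosed F → ν₂ F ≤ ν₁ F := by
    intro F hF
    rw [hν₁, hν₂, Measure.map_apply hmu hF.measurableSet,
      withDensity_apply _ hF.measurableSet, withDensity_apply _ (hmu hF.measurableSet),
      Measure.restrict_restrict hF.measurableSet, ← lintegral_indicator (hmu hF.measurableSet)]
    exact h.lintegral_profile_le_of_isClosed hP h0 hF
  have hfin : IsFiniteMeasure ν₁ := by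
    obtain ⟨L, hL0, hL⟩ := h.exists_fderiv_le hP
    refine ⟨?_⟩
    rw [hν₁, Measure.map_apply hmu .univ, preimage_univ, withDensity_apply _ .univ,
      Measure.restrict_univ]
    refine lt_of_le_of_lt (lintegral_mono (g := {x : Pt | |x 0| ≤ R}.indicator
      fun _ => (L : ℝ≥0∞)) fun x => ?_) ?_
    · by_cases hx : |x 0| ≤ R
      · rw [indicator_of_mem (by exact hx)]
        exact ENNReal.coe_le_coe.2 (hL x)
      · simp [← ofReal_norm, h.fderiv_eq_zero hx]
    · rw [lintegral_indicator_const (isClosed_axial _).measurableSet,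
        Measure.restrict_apply (isClosed_axial _).measurableSet]
      exact ENNReal.mul_lt_top ENNReal.coe_lt_top
        (isBounded_axial_inter_cylFund P R).measure_lt_top
  have hfin₂ : IsFiniteMeasure ν₂ := ⟨(hcl _ isClosed_univ).trans_lt (measure_lt_top _ _)⟩
  have hle : ν₂ ≤ ν₁ := by
    refine Measure.le_iff.2 fun S hS => ?_
    rw [hS.measure_eq_iSup_isClosed_of_ne_top (measure_ne_top _ _)]
    exact iSup₂_le fun F hFS => iSup_le fun hF => (hcl F hF).trans (measure_mono hFS)
  have hint := lintegral_mono' hle (le_refl ψ)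
  have hψu : Measurable fun x => ψ (u x) := hψ.comp hmu
  rw [hν₁, hν₂, lintegral_map hψ hmu, lintegral_withDensity_eq_lintegral_mul _ hmp hψ,
    lintegral_withDensity_eq_lintegral_mul _ hmd hψu] at hint
  simpa only [Pi.mul_apply, mul_comm] using hint

end IsCylTest

/-- The entire function `∑ (-y)ᵏ / (k! (k + j)!)`, equal to `y ^ (-j / 2) J_j(2 √y)`. -/
def besselEntire (j : ℕ) (y : ℝ) : ℝ :=
  ∑' k : ℕ, (-y) ^ k / ((k.factorial : ℝ) * ((k + j).factorial : ℝ))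

namespace besselEntire

theorem norm_term_le (j k : ℕ) (y : ℝ) :
    ‖(-y) ^ k / ((k.factorial : ℝ) * ((k + j).factorial : ℝ))‖ ≤ |y| ^ k / k.factorial := by
  rw [norm_div, norm_pow, norm_neg, Real.norm_eq_abs, norm_mul, Real.norm_natCast,
    Real.norm_natCast]
  have h1 : (1 : ℝ) ≤ (k + j).factorial := by exact_mod_cast Nat.factorial_pos _
  have h2 : (0 : ℝ) < k.factorial := by exact_mod_cast Nat.factorial_pos _
  gcongr
  nlinarith

theorem summable (j : ℕ) (y : ℝ) :
    Summable fun k : ℕ => (-y) ^ k / ((k.factorial : ℝ) * ((k + j).factorial : ℝ)) :=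
  .of_norm_bounded (Real.summable_pow_div_factorial |y|) fun k => norm_term_le j k y

theorem apply_zero (j : ℕ) : besselEntire j 0 = 1 / (j.factorial : ℝ) := by
  rw [besselEntire, tsum_eq_single 0 fun k hk => by simp [hk]]
  simp

theorem hasDerivAt (j : ℕ) (y : ℝ) :
    HasDerivAt (besselEntire j) (-besselEntire (j + 1) y) y := by
  set r : ℝ := |y| + 1
  have hr : 0 ≤ r := by positivity
  have hterm : ∀ k : ℕ, ∀ x : ℝ, -(((k + 1 : ℕ) : ℝ) * (-x) ^ k) /
      (((k + 1).factorial : ℝ) * ((k + 1 + j).factorial : ℝ)) =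
      -((-x) ^ k / ((k.factorial : ℝ) * ((k + (j + 1)).factorial : ℝ))) := by
    intro k x
    rw [Nat.factorial_succ, show k + 1 + j = k + (j + 1) by ring]
    have h2 : (k.factorial : ℝ) ≠ 0 := by exact_mod_cast Nat.factorial_ne_zero _
    have h3 : ((k + (j + 1)).factorial : ℝ) ≠ 0 := by exact_mod_cast Nat.factorial_ne_zero _
    push_cast
    field_simp
  have key := hasDerivAt_tsum_of_isPreconnected
    (g := fun k x => (-x) ^ k / ((k.factorial : ℝ) * ((k + j).factorial : ℝ)))
    (g' := fun k x => -((k : ℝ) * (-x) ^ (k - 1)) /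
      ((k.factorial : ℝ) * ((k + j).factorial : ℝ)))
    (u := fun k => if k = 0 then 0 else r ^ (k - 1) / (k - 1).factorial) (t := ball 0 r)
    (y₀ := y) (y := y) ?_ isOpen_ball (convex_ball _ _).isPreconnected ?_ ?_ ?_ (summable j y) ?_
  · refine key.congr_deriv ?_
    rw [Summable.tsum_eq_zero_add, besselEntire]
    · simp only [Nat.add_sub_cancel, hterm, tsum_neg]
      simp
    · refine (summable_nat_add_iff 1).1 ?_
      simp only [Nat.add_sub_cancel, hterm]
      exact (summable (j + 1) y).neg
  · refine (summable_nat_add_iff 1).1 ?_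
    simpa using Real.summable_pow_div_factorial r
  · intro k x _
    have := (((hasDerivAt_id x).neg).pow k).div_const
      ((k.factorial : ℝ) * ((k + j).factorial : ℝ))
    refine this.congr_deriv ?_
    simp
  · intro k x hx
    rcases k with _ | k
    · simp
    · simp only [Nat.add_sub_cancel, hterm, norm_neg, Nat.add_eq_zero_iff, one_ne_zero, and_false,
        if_false]
      refine (norm_term_le (j + 1) k x).trans ?_
      have : |x| ≤ r := by simpa using (mem_ball_zero_iff.1 hx).le
      gcongr
  · simp [r]
  · simp [r]

theorem continuous (j : ℕ) : Continuous (besselEntire j) :=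
  continuous_iff_continuousAt.2 fun y => (hasDerivAt j y).continuousAt

theorem recurrence (y : ℝ) :
    besselEntire 0 y = besselEntire 1 y - y * besselEntire 2 y := by
  have h0 := summable 0 y
  have h1 := summable 1 y
  have h2 := summable 2 y
  unfold besselEntire
  rw [h0.tsum_eq_zero_add, h1.tsum_eq_zero_add, ← tsum_mul_left]
  have h1' := (summable_nat_add_iff 1).2 h1
  have h2' := h2.mul_left y
  rw [add_sub_assoc, ← h1'.tsum_sub h2']
  congr 1
  · refine tsum_congr fun k => ?_
    have e1 : (k + 1).factorial = (k + 1) * k.factorial := Nat.factorial_succ k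
    have e2 : (k + 1 + 1).factorial = (k + 2) * ((k + 1) * k.factorial) := by
      rw [Nat.factorial_succ, Nat.factorial_succ]
    have h3 : (k.factorial : ℝ) ≠ 0 := by exact_mod_cast Nat.factorial_ne_zero _
    rw [e2, e1, pow_succ]
    push_cast
    field_simp
    ring

theorem hasDerivAt_mul (y : ℝ) :
    HasDerivAt (fun y => y * besselEntire 1 y) (besselEntire 0 y) y := by
  refine ((hasDerivAt_id y).mul (hasDerivAt 1 y)).congr_deriv ?_
  rw [recurrence]
  simp only [id]
  ring

theorem two_neg : besselEntire 0 2 < 0 := by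
  have h := summable 0 2
  unfold besselEntire
  rw [← h.sum_add_tsum_nat_add 6]
  have : ‖∑' k : ℕ, (-2 : ℝ) ^ (k + 6) / (((k + 6).factorial : ℝ) * ((k + 6 + 0).factorial : ℝ))‖ ≤
      1 / 10 := by
    refine tsum_of_norm_bounded (g := fun k : ℕ => 1 / 20 * (1 / 2 : ℝ) ^ k) ?_ fun k => ?_
    · simpa [show (20 : ℝ)⁻¹ * 2 = 10⁻¹ by norm_num] using
        hasSum_geometric_two.mul_left (1 / 20 : ℝ)
    · rw [norm_div, norm_pow, norm_neg, Real.norm_ofNat, norm_mul, Real.norm_natCast, pow_add]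
      have hf : (720 * 4 ^ k : ℝ) ≤ (k + 6).factorial := by
        induction k with
        | zero => norm_num [Nat.factorial]
        | succ k ih =>
          rw [show k + 1 + 6 = (k + 6) + 1 by ring, Nat.factorial_succ, pow_succ]
          push_cast
          have : (0 : ℝ) ≤ k := Nat.cast_nonneg k
          nlinarith [(by positivity : (0 : ℝ) < (k + 6).factorial)]
      have h4 : (4 : ℝ) ^ k = 2 ^ k * 2 ^ k := by rw [← mul_pow]; norm_num
      rw [div_le_iff₀ (by positivity), one_div_pow]
      have h1 : (1 : ℝ) ≤ 2 ^ k := one_le_pow₀ (by norm_num)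
      field_simp
      rw [h4] at hf
      have h5 := pow_le_pow_left₀ (by positivity) hf 2
      nlinarith [one_le_pow₀ h1 (n := 2), sq_nonneg ((2 : ℝ) ^ k)]
  have h2 := (abs_le.1 this).2
  norm_num [Finset.sum_range_succ, Nat.factorial] at h2 ⊢
  linarith

/-- There is a first positive zero of `besselEntire 0`. -/
theorem exists_first_zero : ∃ y₀ > 0, besselEntire 0 y₀ = 0 ∧
    ∀ y, 0 ≤ y → y < y₀ → 0 < besselEntire 0 y := by
  set S : Set ℝ := Icc 0 2 ∩ {y | besselEntire 0 y ≤ 0}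
  have hS : IsCompact S := isCompact_Icc.inter_right (isClosed_le (continuous 0) continuous_const)
  obtain ⟨y₀, hy₀, hmin⟩ := hS.exists_isLeast ⟨2, by simp, two_neg.le⟩
  have h0 : besselEntire 0 0 = 1 := by simp [apply_zero]
  have hpos : ∀ y, 0 ≤ y → y < y₀ → 0 < besselEntire 0 y := fun y hy hlt => by
    by_contra hcon
    exact absurd (hmin ⟨⟨hy, hlt.le.trans hy₀.1.2⟩, not_lt.1 hcon⟩) (not_le.2 hlt)
  have hy0 : 0 < y₀ := by
    refine lt_of_le_of_ne hy₀.1.1 fun h => ?_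
    have h1 : besselEntire 0 y₀ ≤ 0 := hy₀.2
    rw [← h, h0] at h1
    linarith
  refine ⟨y₀, hy0, le_antisymm hy₀.2 ?_, hpos⟩
  refine ge_of_tendsto ((continuous 0).continuousWithinAt (s := Iio y₀) (x := y₀)) ?_
  filter_upwards [Ioo_mem_nhdsLT hy0] with y hy
  exact (hpos y hy.1.le hy.2).le

theorem one_pos {y₀ : ℝ} (hpos : ∀ y, 0 ≤ y → y < y₀ → 0 < besselEntire 0 y) {y : ℝ}
    (hy : 0 ≤ y) (hlt : y ≤ y₀) : 0 < besselEntire 1 y := by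
  rcases hy.eq_or_lt with rfl | hy
  · simp [apply_zero]
  · have hmono : StrictMonoOn (fun y => y * besselEntire 1 y) (Icc 0 y) := by
      refine strictMonoOn_of_deriv_pos (convex_Icc _ _)
        (fun x _ => (hasDerivAt_mul x).continuousAt.continuousWithinAt) fun x hx => ?_
      rw [interior_Icc] at hx
      rw [(hasDerivAt_mul x).deriv]
      exact hpos x hx.1.le (hx.2.trans_le hlt)
    have := hmono (left_mem_Icc.2 hy.le) (right_mem_Icc.2 hy.le) hy
    simp only [zero_mul] at this
    exact pos_of_mul_pos_right this hy.le

/-- The negative of the logarithmic derivative of `besselEntire 0`. -/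
def logDer (y : ℝ) : ℝ := besselEntire 1 y / besselEntire 0 y

theorem discriminant_nonneg {y : ℝ} (hy : 0 < y) :
    0 ≤ besselEntire 1 y ^ 2 - besselEntire 2 y * besselEntire 0 y := by
  set H : ℝ → ℝ := fun y => y * (y * besselEntire 1 y ^ 2 - besselEntire 1 y * besselEntire 0 y +
    besselEntire 0 y ^ 2) with hH
  have hd : ∀ y, HasDerivAt H (y * besselEntire 1 y ^ 2) y := by
    intro y
    have h0 := hasDerivAt 0 y
    have h1 := hasDerivAt 1 y
    have hid := hasDerivAt_id y
    refine (hid.mul (((hid.mul (h1.pow 2)).sub (h1.mul h0)).add (h0.pow 2))).congr_deriv ?_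
    have := recurrence y
    simp only [id, Pi.mul_apply, Pi.pow_apply, Pi.sub_apply, Pi.add_apply, one_mul,
      zero_add, Nat.cast_ofNat, pow_one, Nat.reduceSub, Nat.reduceAdd]
    rw [this]
    ring
  have hmono : MonotoneOn H (Icc 0 y) := by
    refine monotoneOn_of_deriv_nonneg (convex_Icc _ _)
      (fun x _ => (hd x).continuousAt.continuousWithinAt)
      (fun x _ => (hd x).differentiableAt.differentiableWithinAt) fun x hx => ?_
    rw [interior_Icc] at hx
    rw [(hd x).deriv]
    exact mul_nonneg hx.1.le (sq_nonneg _)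
  have h := hmono (left_mem_Icc.2 hy.le) (right_mem_Icc.2 hy.le) hy.le
  have h2 : H y = y ^ 2 * (besselEntire 1 y ^ 2 - besselEntire 2 y * besselEntire 0 y) := by
    have := recurrence y
    simp only [hH]
    linear_combination (y * besselEntire 0 y) * this
  rw [h2] at h
  simp only [hH, zero_mul] at h
  exact nonneg_of_mul_nonneg_right h (by positivity)

theorem hasDerivAt_logDer {y : ℝ} (h : besselEntire 0 y ≠ 0) :
    HasDerivAt logDer ((besselEntire 1 y ^ 2 - besselEntire 2 y * besselEntire 0 y) /
      besselEntire 0 y ^ 2) y := by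
  refine ((hasDerivAt 1 y).div (hasDerivAt 0 y) h).congr_deriv ?_
  congr 1
  ring

theorem hasDerivAt_mul_logDer {y : ℝ} (h : besselEntire 0 y ≠ 0) :
    HasDerivAt (fun y => y * logDer y) (1 + y * logDer y ^ 2) y := by
  refine ((hasDerivAt_mul y).div (hasDerivAt 0 y) h).congr_deriv ?_ |>.congr_of_eventuallyEq ?_
  · rw [logDer]
    field_simp
    ring
  · exact .of_forall fun y => by simp [logDer, mul_div_assoc]

theorem logDer_nonneg {y₀ : ℝ} (hpos : ∀ y, 0 ≤ y → y < y₀ → 0 < besselEntire 0 y) {y : ℝ}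
    (hy : 0 ≤ y) (hlt : y < y₀) : 0 ≤ logDer y :=
  div_nonneg (one_pos hpos hy hlt.le).le (hpos y hy hlt).le

theorem monotoneOn_logDer {y₀ : ℝ} (hpos : ∀ y, 0 ≤ y → y < y₀ → 0 < besselEntire 0 y) :
    MonotoneOn logDer (Ico 0 y₀) := by
  have hd : ∀ y ∈ Ico 0 y₀, HasDerivAt logDer _ y := fun y hy =>
    hasDerivAt_logDer (hpos y hy.1 hy.2).ne'
  refine monotoneOn_of_deriv_nonneg (convex_Ico _ _)
    (fun x hx => (hd x hx).continuousAt.continuousWithinAt)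
    (fun x hx => (hd x (interior_subset hx)).differentiableAt.differentiableWithinAt) fun x hx => ?_
  rw [(hd x (interior_subset hx)).deriv]
  rw [interior_Ico] at hx
  exact div_nonneg (discriminant_nonneg hx.1) (sq_nonneg _)

/-- The weight used in the comparison with the disc. -/
theorem exists_weight {y₀ : ℝ} (hpos : ∀ y, 0 ≤ y → y < y₀ → 0 < besselEntire 0 y) {K M : ℝ}
    (hK : 0 < K) (hM : 0 < M) (hKM : K * M < 4 * Real.pi * y₀) :
    ∃ Q : ℝ → ℝ, Monotone Q ∧ (∀ m, 0 ≤ Q m) ∧ ∀ m, 0 ≤ m → m ≤ M →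
      √(Q m) * (2 * √(Real.pi * m)) = K * m + ∫ t in 0..m, Q t := by
  have hpi := Real.pi_pos
  set τ : ℝ → ℝ := fun m => K * (max 0 (min m M)) / (4 * Real.pi) with hτ
  have hτmono : Monotone τ := fun a b hab => by
    simp only [hτ]
    gcongr
  have hτmem : ∀ m, τ m ∈ Ico 0 y₀ := fun m => by
    refine ⟨by positivity, ?_⟩
    simp only [hτ]
    rw [div_lt_iff₀ (by positivity)]
    have : max 0 (min m M) ≤ M := max_le hM.le (min_le_right _ _)
    nlinarith
  have hτeq : ∀ m, 0 ≤ m → m ≤ M → τ m = K / (4 * Real.pi) * m := fun m h0 h1 => by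
    simp only [hτ, min_eq_left h1, max_eq_right h0]
    ring
  refine ⟨fun m => K * (τ m * logDer (τ m) ^ 2), fun a b hab => ?_, fun m => ?_, ?_⟩
  · have h1 := monotoneOn_logDer hpos (hτmem a) (hτmem b) (hτmono hab)
    have h2 := logDer_nonneg hpos (hτmem a).1 (hτmem a).2
    have h3 := hτmono hab
    have h4 := (hτmem a).1
    dsimp only
    gcongr
  · have := (hτmem m).1
    positivity
  intro m hm0 hmM
  have hne : ∀ t, 0 ≤ t → t ≤ M → besselEntire 0 (K / (4 * Real.pi) * t) ≠ 0 := fun t h0 h1 => by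
    rw [← hτeq t h0 h1]
    exact (hpos _ (hτmem t).1 (hτmem t).2).ne'
  have hint : ∫ t in (0 : ℝ)..m, K * (τ t * logDer (τ t) ^ 2) =
      ∫ t in (0 : ℝ)..m, (K * (1 + K / (4 * Real.pi) * t * logDer (K / (4 * Real.pi) * t) ^ 2) - K) := by
    refine intervalIntegral.integral_congr fun t ht => ?_
    rw [uIcc_of_le hm0] at ht
    rw [hτeq t ht.1 (ht.2.trans hmM)]
    ring
  have hd : ∀ t ∈ uIcc 0 m, HasDerivAt
      (fun t => 4 * Real.pi * (K / (4 * Real.pi) * t * logDer (K / (4 * Real.pi) * t)) - K * t)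
      (K * (1 + K / (4 * Real.pi) * t * logDer (K / (4 * Real.pi) * t) ^ 2) - K) t := by
    intro t ht
    rw [uIcc_of_le hm0] at ht
    have h1 := hasDerivAt_mul_logDer (hne t ht.1 (ht.2.trans hmM))
    have h2 := (hasDerivAt_id t).const_mul (K / (4 * Real.pi))
    have h3 := ((HasDerivAt.comp t h1 h2).const_mul (4 * Real.pi)).sub
      ((hasDerivAt_id t).const_mul K)
    refine h3.congr_deriv ?_
    field_simp
  have hcont : ContinuousOn (fun t => K * (1 + K / (4 * Real.pi) * t *
      logDer (K / (4 * Real.pi) * t) ^ 2) - K) (uIcc 0 m) := by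
    intro t ht
    rw [uIcc_of_le hm0] at ht
    have h1 : ContinuousAt (fun t => logDer (K / (4 * Real.pi) * t)) t :=
      ContinuousAt.comp (f := fun t => K / (4 * Real.pi) * t)
        (hasDerivAt_logDer (hne t ht.1 (ht.2.trans hmM))).continuousAt (by fun_prop)
    exact (by fun_prop : ContinuousAt (fun t => K * (1 + K / (4 * Real.pi) * t *
      logDer (K / (4 * Real.pi) * t) ^ 2) - K) t).continuousWithinAt
  dsimp only
  rw [hint, intervalIntegral.integral_eq_sub_of_hasDerivAt hd hcont.intervalIntegrable]
  have hl := logDer_nonneg hpos (hτmem m).1 (hτmem m).2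
  rw [hτeq m hm0 hmM] at hl ⊢
  rw [mul_left_comm, ← Real.sqrt_mul (by positivity)]
  have : K * (K / (4 * Real.pi) * m * logDer (K / (4 * Real.pi) * m) ^ 2) * (Real.pi * m) =
      (K * m * logDer (K / (4 * Real.pi) * m) / 2) ^ 2 := by
    field_simp
    ring
  rw [this, Real.sqrt_sq (by positivity)]
  field_simp
  ring

end besselEntire

theorem norm_gradient_eq_norm_fderiv (v : Pt → ℝ) (x : Pt) : ‖gradient v x‖ = ‖fderiv ℝ v x‖ := by
  simp [gradient]

theorem firstDirichletEV_nonneg (V : Set Pt) : 0 ≤ firstDirichletEV V := by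
  refine Real.sInf_nonneg ?_
  rintro r ⟨v, -, -, -, -, rfl⟩
  positivity

theorem firstDirichletEV_mul_le {V : Set Pt} {v : Pt → ℝ} (hv : ContDiff ℝ 1 v)
    (hc : HasCompactSupport v) (hs : tsupport v ⊆ V) :
    firstDirichletEV V * ∫ x in V, v x ^ 2 ≤ ∫ x in V, ‖gradient v x‖ ^ 2 := by
  by_cases h0 : ∫ x in V, v x ^ 2 = 0
  · rw [h0, mul_zero]
    positivity
  rw [← le_div_iff₀ (lt_of_le_of_ne (by positivity) (Ne.symm h0))]
  refine csInf_le ⟨0, ?_⟩ ⟨v, hv, hc, hs, h0, rfl⟩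
  rintro r ⟨v, -, -, -, -, rfl⟩
  positivity

theorem setIntegral_ball_radial {F : ℝ → ℝ} (hF : ∀ ρ, 1 ≤ ρ → F ρ = 0) :
    ∫ x in ball (0 : Pt) 1, F (‖x‖ ^ 2) =
      volume.real (ball (0 : Pt) 1) * ∫ ρ in (0 : ℝ)..1, F ρ := by
  rw [setIntegral_eq_integral_of_forall_compl_eq_zero fun x hx => ?_]
  swap
  · refine hF _ (one_le_pow₀ ?_)
    simpa using hx
  rw [integral_fun_norm_addHaar volume fun r => F (r ^ 2), finrank_euclideanSpace, Fintype.card_fin]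
  have h1 : ∫ ρ in (0 : ℝ)..1, F ρ = ∫ ρ in Ioi 0, F ρ := by
    rw [intervalIntegral.integral_of_le zero_le_one]
    refine (setIntegral_eq_of_subset_of_forall_sdiff_eq_zero measurableSet_Ioi
      Ioc_subset_Ioi_self fun x hx => hF x ?_).symm
    by_contra! hlt
    exact hx.2 ⟨hx.1, hlt.le⟩
  rw [h1, ← integral_comp_rpow_Ioi_of_pos (g := F) two_pos, nsmul_eq_mul, smul_eq_mul, mul_left_comm]
  congr 1
  rw [← integral_const_mul]
  refine setIntegral_congr_fun measurableSet_Ioi fun x hx => ?_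
  norm_num
  ring

/-- Radial test functions for the disc, in the variable `y = y₀ ‖x‖²`. -/
theorem lambda1Disk_mul_le_of_radial {y₀ y₁ : ℝ} (hy₀ : 0 < y₀) (hy₁ : y₁ < y₀) {g : ℝ → ℝ}
    (hg : ContDiff ℝ 1 g) (hz : ∀ y, y₁ ≤ y → g y = 0) :
    lambda1Disk * ∫ y in (0 : ℝ)..y₀, g y ^ 2 ≤ 4 * y₀ * ∫ y in (0 : ℝ)..y₀, y * deriv g y ^ 2 := by
  have hvol : 0 < volume.real (ball (0 : Pt) 1) :=
    ENNReal.toReal_pos (measure_ball_pos _ _ one_pos).ne' measure_ball_lt_top.ne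
  set v : Pt → ℝ := fun x => g (y₀ * ‖x‖ ^ 2) with hv
  have hvc : ContDiff ℝ 1 v := hg.comp (contDiff_const.mul (contDiff_norm_sq ℝ))
  have hsupp : tsupport v ⊆ closedBall 0 √(y₁ / y₀) := by
    refine closure_minimal (fun x hx => ?_) isClosed_closedBall
    rw [mem_closedBall_zero_iff]
    refine Real.le_sqrt_of_sq_le ?_
    rw [le_div_iff₀ hy₀]
    by_contra! hlt
    exact hx (hz _ (by linarith))
  have hdg : ∀ y, y₀ ≤ y → deriv g y = 0 := fun y hy => by
    have : g =ᶠ[𝓝 y] fun _ => 0 := by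
      filter_upwards [Ioi_mem_nhds (hy₁.trans_le hy)] with z hz'
      exact hz z (le_of_lt hz')
    rw [this.deriv_eq, deriv_const]
  have hgrad : ∀ x : Pt, ‖gradient v x‖ ^ 2 = 4 * y₀ * (y₀ * ‖x‖ ^ 2 * deriv g (y₀ * ‖x‖ ^ 2) ^ 2) := by
    intro x
    have h1 := ((hasStrictFDerivAt_norm_sq x).hasFDerivAt.const_mul y₀)
    have h2 := (hg.differentiable one_ne_zero (y₀ * ‖x‖ ^ 2)).hasDerivAt.comp_hasFDerivAt x h1
    rw [norm_gradient_eq_norm_fderiv, hv, show (fun x : Pt => g (y₀ * ‖x‖ ^ 2)) =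
      g ∘ fun x : Pt => y₀ * ‖x‖ ^ 2 from rfl, h2.fderiv, norm_smul, norm_smul,
      show (2 • (innerSL ℝ) x) = (2 : ℝ) • (innerSL ℝ) x from (Nat.cast_smul_eq_nsmul ℝ 2 _).symm,
      norm_smul, innerSL_apply_norm, Real.norm_ofNat, Real.norm_of_nonneg hy₀.le, mul_pow,
      Real.norm_eq_abs, sq_abs]
    ring
  have hball : tsupport v ⊆ ball 0 1 := hsupp.trans <| closedBall_subset_ball <| by
    rw [Real.sqrt_lt' one_pos, one_pow, div_lt_one hy₀]
    exact hy₁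
  have key := firstDirichletEV_mul_le hvc
    ((isCompact_closedBall _ _).of_isClosed_subset (isClosed_tsupport v) hsupp) hball
  simp_rw [hgrad, hv] at key
  rw [setIntegral_ball_radial (F := fun ρ => g (y₀ * ρ) ^ 2) fun ρ hρ => by
      rw [hz _ (by nlinarith), zero_pow two_ne_zero],
    setIntegral_ball_radial (F := fun ρ => 4 * y₀ * (y₀ * ρ * deriv g (y₀ * ρ) ^ 2)) fun ρ hρ => by
      rw [hdg _ (by nlinarith)]; ring,
    intervalIntegral.integral_comp_mul_left (fun y => g y ^ 2) hy₀.ne',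
    intervalIntegral.integral_comp_mul_left (fun y => 4 * y₀ * (y * deriv g y ^ 2)) hy₀.ne',
    intervalIntegral.integral_const_mul, mul_zero, mul_one, smul_eq_mul, smul_eq_mul] at key
  have hc : 0 < volume.real (ball (0 : Pt) 1) * y₀⁻¹ := by positivity
  refine le_of_mul_le_mul_left ?_ hc
  rw [lambda1Disk]
  linarith

theorem lambda1Disk_nonneg : 0 ≤ lambda1Disk := firstDirichletEV_nonneg _

/-- The first eigenvalue of the disc is at most `4 y₀`, where `y₀` is the first zero of
`besselEntire 0`. -/
theorem lambda1Disk_le {y₀ : ℝ} (hy₀ : 0 < y₀) (h0 : besselEntire 0 y₀ = 0)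
    (hpos : ∀ y, 0 ≤ y → y < y₀ → 0 < besselEntire 0 y) : lambda1Disk ≤ 4 * y₀ := by
  set E := besselEntire
  have hc := besselEntire.continuous
  have hd := besselEntire.hasDerivAt
  set A := ∫ y in (0 : ℝ)..y₀, E 0 y ^ 2 with hA
  set B := ∫ y in (0 : ℝ)..y₀, E 0 y
  have hii : ∀ {f : ℝ → ℝ} {a b : ℝ}, Continuous f → IntervalIntegrable f volume a b :=
    fun hf => hf.intervalIntegrable _ _
  have hEnn : ∀ y ∈ Icc 0 y₀, 0 ≤ E 0 y := fun y hy => by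
    rcases hy.2.eq_or_lt with rfl | hlt
    · exact h0.ge
    · exact (hpos y hy.1 hlt).le
  have hc0 : Continuous fun y => E 0 y ^ 2 := (hc 0).pow 2
  have hApos : 0 < A := intervalIntegral.intervalIntegral_pos_of_pos_on (hii hc0)
    (fun y hy => pow_pos (hpos y hy.1.le hy.2) 2) hy₀
  have hA' : ∫ y in (0 : ℝ)..y₀, y * E 1 y ^ 2 = A := by
    have h1 : ∀ y ∈ uIcc 0 y₀, HasDerivAt (fun y => y * E 1 y * E 0 y)
        (E 0 y ^ 2 - y * E 1 y ^ 2) y := fun y _ => by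
      refine ((besselEntire.hasDerivAt_mul y).mul (hd 0 y)).congr_deriv ?_
      simp only [E, zero_add]
      ring
    have hc1 : Continuous fun y => y * E 1 y ^ 2 := continuous_id.mul ((hc 1).pow 2)
    have h2 := intervalIntegral.integral_eq_sub_of_hasDerivAt h1 (hii (hc0.sub hc1))
    rw [intervalIntegral.integral_sub (hii hc0) (hii hc1)] at h2
    simp only [h0, E, mul_zero, zero_mul, sub_zero] at h2
    linarith
  have hFTC : ∀ a b, ∫ t in a..b, E 1 t = E 0 a - E 0 b := fun a b => by
    have := intervalIntegral.integral_eq_sub_of_hasDerivAt (a := a) (b := b)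
      (fun y _ => (hd 0 y).neg) (hii (by simpa using hc 1))
    simp only [neg_neg, zero_add, Pi.neg_apply] at this
    rw [this]
    ring
  have hE1 : ∀ y ∈ Icc 0 y₀, 0 ≤ E 1 y := fun y hy => (besselEntire.one_pos hpos hy.1 hy.2).le
  have key : ∀ a ∈ Ioo 0 y₀, lambda1Disk * (A - 2 * E 0 a * B) ≤ 4 * y₀ * A := by
    intro a ha
    obtain ⟨b, hab, hb⟩ := exists_between ha.2
    set χ : ℝ → ℝ := fun t => max 0 (min 1 ((b - t) / (b - a)))
    have hχc : Continuous χ := by fun_prop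
    have hχ0 : ∀ t, 0 ≤ χ t := fun t => le_max_left _ _
    have hχ1 : ∀ t, χ t ≤ 1 := fun t => max_le zero_le_one (min_le_left _ _)
    have hχa : ∀ t ≤ a, χ t = 1 := fun t ht => by
      have : 1 ≤ (b - t) / (b - a) := by
        rw [le_div_iff₀ (by linarith)]
        linarith
      simp only [χ, min_eq_left this, max_eq_right zero_le_one]
    have hχb : ∀ t, b ≤ t → χ t = 0 := fun t ht => by
      have : (b - t) / (b - a) ≤ 0 := div_nonpos_of_nonpos_of_nonneg (by linarith) (by linarith)
      exact max_eq_left ((min_le_right _ _).trans this)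
    have hχE : Continuous fun t => χ t * E 1 t := hχc.mul (hc 1)
    set g : ℝ → ℝ := fun y => ∫ t in y..y₀, χ t * E 1 t
    have hgd : ∀ y, HasDerivAt g (-(χ y * E 1 y)) y := fun y =>
      intervalIntegral.integral_hasDerivAt_left (hii hχE)
        hχE.aestronglyMeasurable.stronglyMeasurableAtFilter hχE.continuousAt
    have hderiv : deriv g = fun y => -(χ y * E 1 y) := funext fun y => (hgd y).deriv
    have hgC : ContDiff ℝ 1 g := contDiff_one_iff_deriv.2
      ⟨fun y => (hgd y).differentiableAt, by rw [hderiv]; exact hχE.neg⟩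
    have hgb : ∀ y, b ≤ y → g y = 0 := fun y hy => by
      refine (intervalIntegral.integral_congr (g := fun _ => 0) fun t ht => ?_).trans (by simp)
      have : b ≤ t := (le_min hy hb.le).trans ht.1
      simp only [hχb t this, zero_mul]
    have hg0 : ∀ y ∈ Icc 0 y₀, 0 ≤ g y := fun y hy =>
      intervalIntegral.integral_nonneg hy.2 fun t ht =>
        mul_nonneg (hχ0 t) (hE1 t ⟨hy.1.trans ht.1, ht.2⟩)
    have hga : ∀ y ∈ Icc 0 y₀, E 0 y - E 0 a ≤ g y := by
      intro y hy
      rcases le_total y a with hya | hya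
      · have h1 : g y = (∫ t in y..a, χ t * E 1 t) + ∫ t in a..y₀, χ t * E 1 t :=
          (intervalIntegral.integral_add_adjacent_intervals (hii hχE) (hii hχE)).symm
        have h2 : ∫ t in y..a, χ t * E 1 t = E 0 y - E 0 a := by
          rw [← hFTC]
          refine intervalIntegral.integral_congr fun t ht => ?_
          rw [uIcc_of_le hya] at ht
          simp only [hχa t ht.2, one_mul]
        have h3 := hg0 a ⟨ha.1.le, ha.2.le⟩
        simp only [g] at h3 h1 ⊢
        linarith
      · have h1 := hFTC a y
        have h2 : 0 ≤ ∫ t in a..y, E 1 t := intervalIntegral.integral_nonneg hya fun t ht =>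
          hE1 t ⟨ha.1.le.trans ht.1, ht.2.trans hy.2⟩
        linarith [hg0 y hy]
    have h1 := lambda1Disk_mul_le_of_radial hy₀ hb hgC hgb
    have h2 : ∫ y in (0 : ℝ)..y₀, y * deriv g y ^ 2 ≤ A := by
      rw [← hA', hderiv]
      refine intervalIntegral.integral_mono_on hy₀.le
        (hii (continuous_id.mul (hχE.neg.pow 2))) (hii (continuous_id.mul ((hc 1).pow 2)))
        fun y hy => mul_le_mul_of_nonneg_left ?_ hy.1
      rw [neg_sq, mul_pow]
      exact mul_le_of_le_one_left (sq_nonneg _) (pow_le_one₀ (hχ0 y) (hχ1 y))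
    have hca : Continuous fun y => 2 * E 0 a * E 0 y := continuous_const.mul (hc 0)
    have h3 : A - 2 * E 0 a * B ≤ ∫ y in (0 : ℝ)..y₀, g y ^ 2 := by
      rw [hA, ← intervalIntegral.integral_const_mul,
        ← intervalIntegral.integral_sub (hii hc0) (hii hca)]
      refine intervalIntegral.integral_mono_on hy₀.le
        (hii (hc0.sub hca)) (hii (hgC.continuous.pow 2))
        fun y hy => ?_
      have e1 := hga y hy
      have e2 := hg0 y hy
      have e3 := hEnn y hy
      have e4 := hEnn a ⟨ha.1.le, ha.2.le⟩
      rcases le_total (E 0 a) (E 0 y) with hle | hle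
      · nlinarith
      · nlinarith
    calc _ ≤ lambda1Disk * ∫ y in (0 : ℝ)..y₀, g y ^ 2 :=
          mul_le_mul_of_nonneg_left h3 lambda1Disk_nonneg
      _ ≤ _ := h1.trans (by gcongr)
  have hlim : Tendsto (fun a => lambda1Disk * (A - 2 * E 0 a * B)) (𝓝[<] y₀)
      (𝓝 (lambda1Disk * (A - 2 * E 0 y₀ * B))) :=
    (continuous_const.mul (continuous_const.sub ((continuous_const.mul (hc 0)).mul
      continuous_const))).continuousWithinAt
  have := le_of_tendsto hlim (by
    filter_upwards [Ioo_mem_nhdsLT hy₀] with a ha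
    exact key a ha)
  rw [h0, mul_zero, zero_mul, sub_zero] at this
  exact le_of_mul_le_mul_right this hApos

theorem antitone_measure_Ioi_toReal (ν : Measure ℝ) [IsFiniteMeasure ν] :
    Antitone fun t => (ν (Ioi t)).toReal := fun _ _ hab =>
  ENNReal.toReal_mono (measure_ne_top _ _) (measure_mono (Ioi_subset_Ioi hab))

theorem measure_le_measure_Ioi_le (ν : Measure ℝ) [IsFiniteMeasure ν] (a : ℝ) :
    ν {t | a ≤ (ν (Ioi t)).toReal} ≤ ENNReal.ofReal ((ν univ).toReal - a) := by
  have hS : MeasurableSet {t | a ≤ (ν (Ioi t)).toReal} :=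
    measurableSet_le measurable_const (antitone_measure_Ioi_toReal ν).measurable
  rw [hS.measure_eq_iSup_isCompact_of_ne_top (measure_ne_top _ _)]
  refine iSup₂_le fun C hC => iSup_le fun hcomp => ?_
  rcases C.eq_empty_or_nonempty with rfl | hne
  · simp
  obtain ⟨t, ht, hmax⟩ := hcomp.exists_isGreatest hne
  have ha : a ≤ (ν (Ioi t)).toReal := hC ht
  calc ν C ≤ ν (Iic t) := measure_mono fun x hx => hmax hx
    _ = ν univ - ν (Ioi t) := by
      rw [← compl_Ioi, measure_compl measurableSet_Ioi (measure_ne_top _ _)]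
    _ ≤ _ := by
      rw [← ENNReal.ofReal_toReal (measure_ne_top ν univ),
        ← ENNReal.ofReal_toReal (measure_ne_top ν (Ioi t)),
        ← ENNReal.ofReal_sub _ ENNReal.toReal_nonneg, ENNReal.toReal_ofReal ENNReal.toReal_nonneg]
      exact ENNReal.ofReal_le_ofReal (by linarith)

/-- Comparison of a measure on the line, transformed by its own tail, with Lebesgue measure. -/
theorem lintegral_tail_le (ν : Measure ℝ) [IsFiniteMeasure ν] {Q : ℝ → ℝ} (hQ : Monotone Q)
    (hQ0 : ∀ m, 0 ≤ Q m) :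
    ∫⁻ t, ENNReal.ofReal (Q (ν (Ioi t)).toReal) ∂ν ≤
      ∫⁻ m in Ioc 0 (ν univ).toReal, ENNReal.ofReal (Q m) := by
  have hF := antitone_measure_Ioi_toReal ν
  rw [lintegral_eq_lintegral_meas_lt ν (.of_forall fun t => hQ0 _)
      (hQ.measurable.comp hF.measurable).aemeasurable,
    lintegral_eq_lintegral_meas_lt _ (.of_forall fun t => hQ0 _) hQ.measurable.aemeasurable]
  refine lintegral_mono fun r => ?_
  set m₀ := (ν univ).toReal with hm₀
  have hFm : ∀ t, (ν (Ioi t)).toReal ∈ Icc 0 m₀ := fun t =>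
    ⟨ENNReal.toReal_nonneg, ENNReal.toReal_mono (measure_ne_top _ _) (measure_mono (subset_univ _))⟩
  set A : Set ℝ := {m | r < Q m}
  have hA : MeasurableSet A := measurableSet_lt measurable_const hQ.measurable
  change ν {t | (ν (Ioi t)).toReal ∈ A} ≤ volume.restrict (Ioc 0 m₀) A
  rw [Measure.restrict_apply hA]
  rcases (A ∩ Icc 0 m₀).eq_empty_or_nonempty with hemp | hne
  · refine le_trans (le_of_eq ?_) zero_le
    convert measure_empty (μ := ν)
    refine eq_empty_of_forall_notMem fun t ht => ?_
    exact eq_empty_iff_forall_notMem.1 hemp _ ⟨ht, hFm t⟩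
  have hbdd : BddBelow (A ∩ Icc 0 m₀) := ⟨0, fun x hx => hx.2.1⟩
  set a := sInf (A ∩ Icc 0 m₀)
  have ha0 : 0 ≤ a := le_csInf hne fun x hx => hx.2.1
  calc ν {t | (ν (Ioi t)).toReal ∈ A} ≤ ν {t | a ≤ (ν (Ioi t)).toReal} :=
        measure_mono fun t ht => csInf_le hbdd ⟨ht, hFm t⟩
    _ ≤ ENNReal.ofReal (m₀ - a) := measure_le_measure_Ioi_le ν a
    _ = volume (Ioc a m₀) := Real.volume_Ioc.symm
    _ ≤ _ := by
      refine measure_mono fun m hm => ⟨?_, ha0.trans_lt hm.1, hm.2⟩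
      obtain ⟨m', hm', hlt⟩ := exists_lt_of_csInf_lt hne hm.1
      exact lt_of_lt_of_le hm'.1 (hQ hlt.le)

theorem lintegral_mul_levelArea_le {P : ℝ} {u : Pt → ℝ} (hu : Measurable u) (h0 : ∀ x, 0 ≤ u x)
    (hfin : ∀ s, 0 < s → cylLevelArea P u s < ∞) {Q : ℝ → ℝ} (hQ : Monotone Q)
    (hQ0 : ∀ m, 0 ≤ Q m) :
    ∫⁻ x in cylFund P, ENNReal.ofReal (Q (cylLevelArea P u (u x)).toReal) * ENNReal.ofReal (u x) ≤
      ∫⁻ s in Ioi 0, ∫⁻ m in Ioc 0 (cylLevelArea P u s).toReal, ENNReal.ofReal (Q m) := by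
  have hq : Measurable fun x => ENNReal.ofReal (Q (cylLevelArea P u (u x)).toReal) :=
    (hQ.measurable.comp (IsCylTest.measurable_levelArea.comp hu).ennreal_toReal).ennreal_ofReal
  have h1 := lintegral_withDensity_eq_lintegral_mul (volume.restrict (cylFund P)) hq
    hu.ennreal_ofReal
  simp only [Pi.mul_apply] at h1
  rw [← h1, lintegral_eq_lintegral_meas_lt _ (.of_forall h0) hu.aemeasurable]
  refine setLIntegral_mono' measurableSet_Ioi fun s hs => ?_
  have hs : 0 < s := hs
  have hmeas : ∀ t, MeasurableSet {x | t < u x} := fun t => measurableSet_lt measurable_const hu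
  rw [withDensity_apply _ (hmeas s), Measure.restrict_restrict (hmeas s)]
  set ρ := volume.restrict ({x | s < u x} ∩ cylFund P) with hρ
  have huniv : (ρ.map u) univ = cylLevelArea P u s := by
    rw [Measure.map_apply hu .univ, preimage_univ, hρ, Measure.restrict_apply_univ, cylLevelArea]
  have : IsFiniteMeasure (ρ.map u) := ⟨by rw [huniv]; exact hfin s hs⟩
  have key := lintegral_tail_le (ρ.map u) hQ hQ0
  have hm : Measurable fun t => ENNReal.ofReal (Q ((ρ.map u) (Ioi t)).toReal) :=
    (hQ.measurable.comp (antitone_measure_Ioi_toReal (ρ.map u)).measurable).ennreal_ofReal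
  rw [huniv, lintegral_map hm hu] at key
  refine le_trans (le_of_eq ?_) key
  refine setLIntegral_congr_fun ((hmeas s).inter (measurableSet_cylFund P)) fun x hx => ?_
  have hx : s < u x := hx.1
  rw [Measure.map_apply hu measurableSet_Ioi, hρ, Measure.restrict_apply (hu measurableSet_Ioi),
    cylLevelArea]
  congr 4
  ext y
  exact ⟨fun ⟨h1, h2⟩ => ⟨h1, lt_trans hx h1, h2⟩, fun ⟨h1, _, h2⟩ => ⟨h1, h2⟩⟩

/-- The Faber–Krahn inequality on the cylinder for a single function. -/
theorem faberKrahn_cylinder {P R M K y₀ : ℝ} (hP : 0 < P)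
    (hpos : ∀ y, 0 ≤ y → y < y₀ → 0 < besselEntire 0 y) (hK : 0 < K) (hM : 0 < M)
    (hKM : K * M < 4 * Real.pi * y₀) {v : Pt → ℝ} (hv : ContDiff ℝ 1 v)
    (hper : IsPeriodicFun P v) (hsupp : ∀ x, v x ≠ 0 → |x 0| ≤ R)
    (hvM : volume ({x | v x ≠ 0} ∩ cylFund P) ≤ ENNReal.ofReal M) {c : ℝ} (hc0 : 0 ≤ c)
    (hc1 : c ≤ 1) (hcP : c * √(Real.pi * M) ≤ P) :
    ENNReal.ofReal (c ^ 2 * K) * ∫⁻ x in cylFund P, ENNReal.ofReal (v x ^ 2) ≤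
      ∫⁻ x in {x | v x ≠ 0} ∩ cylFund P, ENNReal.ofReal (‖fderiv ℝ v x‖ ^ 2) := by
  obtain ⟨Q, hQ, hQ0, hQΦ⟩ := besselEntire.exists_weight hpos hK hM hKM
  set u : Pt → ℝ := fun x => v x ^ 2 with hu
  have hut : IsCylTest P R u := by
    refine ⟨hv.pow 2, fun x => by simp only [hu, hper x], fun x hx => hsupp x fun h => hx ?_⟩
    simp only [hu, h, zero_pow two_ne_zero]
  have hu0 : ∀ x, 0 ≤ u x := fun x => sq_nonneg _
  have hum : Measurable u := hut.contDiff.continuous.measurable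
  set μ : ℝ → ℝ := fun s => (cylLevelArea P u s).toReal with hμ
  have hμ0 : ∀ s, 0 ≤ μ s := fun s => ENNReal.toReal_nonneg
  have hμM : ∀ s, 0 ≤ s → μ s ≤ M := fun s hs => by
    refine ENNReal.toReal_le_of_le_ofReal hM.le ((measure_mono ?_).trans hvM)
    refine inter_subset_inter_left _ fun x hx => ?_
    have hx : s < v x ^ 2 := hx
    intro h
    rw [h] at hx
    norm_num at hx
    linarith
  have hμm : Measurable μ := IsCylTest.measurable_levelArea.ennreal_toReal
  set ψ : ℝ → ℝ≥0∞ := fun s => ENNReal.ofReal (c * √(Q (μ s))) with hψ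
  have hψm : Measurable ψ := (((hQ.measurable.comp hμm).sqrt).const_mul c).ennreal_ofReal
  have hcoarea := hut.lintegral_mul_profile_le hP hu0 hψm
  set J := ∫⁻ x in cylFund P, ENNReal.ofReal (Q (μ (u x))) * ENNReal.ofReal (u x) with hJ
  set U := ∫⁻ x in cylFund P, ENNReal.ofReal (u x) with hU
  set G := ∫⁻ x in {x | v x ≠ 0} ∩ cylFund P, ENNReal.ofReal (‖fderiv ℝ v x‖ ^ 2) with hG
  have hJm : Measurable fun x => ENNReal.ofReal (Q (μ (u x))) * ENNReal.ofReal (u x) :=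
    ((hQ.measurable.comp (hμm.comp hum)).ennreal_ofReal).mul hum.ennreal_ofReal
  have hright : ∫⁻ x in cylFund P, ψ (u x) * ‖fderiv ℝ u x‖ₑ ≤
      G + ENNReal.ofReal (c ^ 2) * J := by
    have hne : MeasurableSet {x | v x ≠ 0} :=
      (isOpen_ne_fun hv.continuous continuous_const).measurableSet
    rw [hG, hJ, ← Measure.restrict_restrict hne, ← lintegral_indicator hne,
      ← lintegral_const_mul _ hJm, ← lintegral_add_right _ (hJm.const_mul _)]
    refine lintegral_mono fun x => ?_
    have hd : ‖fderiv ℝ u x‖ = 2 * |v x| * ‖fderiv ℝ v x‖ := by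
      have := ((hv.differentiable one_ne_zero x).hasFDerivAt.pow 2).fderiv
      change ‖fderiv ℝ (fun x => v x ^ 2) x‖ = _
      rw [this, norm_smul]
      simp
    by_cases hx : v x = 0
    · rw [← ofReal_norm, hd, hx]
      simp
    have hx' : x ∈ {x | v x ≠ 0} := hx
    have hq : 0 ≤ Q (μ (u x)) * u x := mul_nonneg (hQ0 _) (hu0 x)
    rw [indicator_of_mem hx', ← ofReal_norm, hd, hψ, ← ENNReal.ofReal_mul (by positivity),
      ← ENNReal.ofReal_mul (hQ0 _), ← ENNReal.ofReal_mul (by positivity),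
      ← ENNReal.ofReal_add (by positivity) (mul_nonneg (sq_nonneg c) hq)]
    refine ENNReal.ofReal_le_ofReal ?_
    have e1 : Q (μ (u x)) * u x = (√(Q (μ (u x))) * |v x|) ^ 2 := by
      rw [mul_pow, Real.sq_sqrt (hQ0 _), sq_abs]
    rw [e1]
    nlinarith [sq_nonneg (‖fderiv ℝ v x‖ - c * (√(Q (μ (u x))) * |v x|))]
  have hleft : ENNReal.ofReal (c ^ 2) * (ENNReal.ofReal K * U + J) ≤
      ∫⁻ s in Ioi 0, ψ s * ENNReal.ofReal (cylProfile P (μ s)) := by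
    have hlayer : U = ∫⁻ s in Ioi 0, cylLevelArea P u s := by
      rw [hU, lintegral_eq_lintegral_meas_lt _ (.of_forall hu0) hum.aemeasurable]
      refine lintegral_congr fun s => ?_
      rw [Measure.restrict_apply (measurableSet_lt measurable_const hum), cylLevelArea]
    have hJle := lintegral_mul_levelArea_le (P := P) hum hu0
      (fun s hs => hut.levelArea_lt_top hs.le) hQ hQ0
    calc _ ≤ ENNReal.ofReal (c ^ 2) * (ENNReal.ofReal K * (∫⁻ s in Ioi 0, cylLevelArea P u s) +
          ∫⁻ s in Ioi 0, ∫⁻ m in Ioc 0 (μ s), ENNReal.ofReal (Q m)) := by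
          rw [← hlayer]
          gcongr
      _ = ∫⁻ s in Ioi 0, ENNReal.ofReal (c ^ 2) * (ENNReal.ofReal K * cylLevelArea P u s +
          ∫⁻ m in Ioc 0 (μ s), ENNReal.ofReal (Q m)) := by
          rw [lintegral_const_mul' _ _ ENNReal.ofReal_ne_top, lintegral_add_left
            (IsCylTest.measurable_levelArea.const_mul _), lintegral_const_mul' _ _ ENNReal.ofReal_ne_top]
      _ ≤ _ := by
          refine setLIntegral_mono' measurableSet_Ioi fun s hs => ?_
          have hs : 0 < s := hs
          have hm0 := hμ0 s
          have hmM := hμM s hs.le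
          have hi : IntegrableOn Q (Ioc 0 (μ s)) :=
            (hQ.intervalIntegrable (a := 0) (b := μ s)).1
          have e1 : cylLevelArea P u s = ENNReal.ofReal (μ s) :=
            (ENNReal.ofReal_toReal (hut.levelArea_lt_top hs.le).ne).symm
          have hnn : 0 ≤ ∫ m in Ioc 0 (μ s), Q m := integral_nonneg fun m => hQ0 m
          rw [e1, ← ofReal_integral_eq_lintegral_ofReal hi (.of_forall fun m => hQ0 m),
            ← ENNReal.ofReal_mul hK.le, ← ENNReal.ofReal_add (by positivity) hnn,
            ← ENNReal.ofReal_mul (sq_nonneg c), hψ, ← ENNReal.ofReal_mul (by positivity),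
            ← intervalIntegral.integral_of_le hm0, ← hQΦ _ hm0 hmM]
          refine ENNReal.ofReal_le_ofReal ?_
          have e2 : c * (2 * √(Real.pi * μ s)) ≤ cylProfile P (μ s) := by
            refine le_min ?_ ?_
            · have : √(Real.pi * μ s) ≤ √(Real.pi * M) := by gcongr
              nlinarith
            · exact mul_le_of_le_one_left (by positivity) hc1
          calc _ = c * √(Q (μ s)) * (c * (2 * √(Real.pi * μ s))) := by ring
            _ ≤ _ := by gcongr
  have hUfin : U ≠ ∞ := by
    have hint : IntegrableOn u (cylFund P) := by
      have h1 : IntegrableOn u (closure ({x : Pt | |x 0| ≤ R} ∩ cylFund P)) :=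
        hut.contDiff.continuous.continuousOn.integrableOn_compact
          (isBounded_axial_inter_cylFund P R).isCompact_closure
      refine (h1.mono_set subset_closure).of_forall_sdiff_eq_zero (measurableSet_cylFund P) ?_
      intro x hx
      by_contra hne
      exact hx.2 ⟨hut.support x hne, hx.1⟩
    exact (hint.lintegral_lt_top).ne
  have hJfin : J ≠ ∞ := by
    have : J ≤ ENNReal.ofReal (Q M) * U := by
      rw [hU, ← lintegral_const_mul _ hum.ennreal_ofReal]
      refine lintegral_mono fun x => ?_
      dsimp only
      gcongr
      exact hQ (hμM _ (hu0 x))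
    exact ne_top_of_le_ne_top (ENNReal.mul_ne_top ENNReal.ofReal_ne_top hUfin) this
  have htot := hleft.trans (hcoarea.trans hright)
  rw [mul_add, ← mul_assoc, ← ENNReal.ofReal_mul (sq_nonneg c)] at htot
  exact (ENNReal.add_le_add_iff_right (ENNReal.mul_ne_top ENNReal.ofReal_ne_top hJfin)).1 htot

theorem HasLipschitzBoundary.isOpen {V : Set Pt} (h : HasLipschitzBoundary V) : IsOpen V := by
  rw [← subset_interior_iff_isOpen]
  intro x hx
  by_contra hxi
  obtain ⟨e, K, f, r, hr, hf, heq⟩ := h x ⟨subset_closure hx, hxi⟩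
  have hfe : Continuous fun y : Pt => f ((e y) 0) := hf.continuous.comp (by fun_prop)
  have hopen : IsOpen (V ∩ ball x r) := by
    rw [heq]
    exact isOpen_ball.inter (isOpen_lt hfe (by fun_prop))
  exact hxi (interior_maximal inter_subset_left hopen ⟨hx, mem_ball_self hr⟩)

theorem rayleigh_le_dirichlet {P R : ℝ} (hP : 0 < P) {V : Set Pt} (hV : MeasurableSet V)
    (hR : ∀ x ∈ V, |x 0| ≤ R) {v : Pt → ℝ} (hv : ContDiff ℝ 1 v) (hper : IsPeriodicFun P v)
    (hvV : ∀ x ∉ V, v x = 0) (hne : (∫ x in V ∩ cylFund P, v x ^ 2) ≠ 0) :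
    0 < cylArea P V ∧
      min 1 (P / √(Real.pi * cylArea P V)) ^ 2 * (Real.pi * lambda1Disk / cylArea P V) *
        (∫ x in V ∩ cylFund P, v x ^ 2) ≤ ∫ x in V ∩ cylFund P, ‖gradient v x‖ ^ 2 := by
  simp only [norm_gradient_eq_norm_fderiv]
  set W := V ∩ cylFund P with hW
  set M := cylArea P V with hMdef
  have hWm : MeasurableSet W := hV.inter (measurableSet_cylFund P)
  have hWb : Bornology.IsBounded W := (isBounded_axial_inter_cylFund P R).subset
    (inter_subset_inter_left _ hR)
  have hWfin : volume W ≠ ∞ := hWb.measure_lt_top.ne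
  have hMvol : volume W = ENNReal.ofReal M := (ENNReal.ofReal_toReal hWfin).symm
  have hM : 0 < M := by
    refine lt_of_le_of_ne ENNReal.toReal_nonneg fun h => hne ?_
    rw [← h, ENNReal.ofReal_zero] at hMvol
    rw [Measure.restrict_eq_zero.2 hMvol, integral_zero_measure]
  refine ⟨hM, ?_⟩
  have hint : ∀ g : Pt → ℝ, Continuous g → IntegrableOn g W := fun g hg =>
    (hg.continuousOn.integrableOn_compact hWb.isCompact_closure).mono_set subset_closure
  have hI := hint (fun x => v x ^ 2) (hv.continuous.pow 2)
  have hD := hint (fun x => ‖fderiv ℝ v x‖ ^ 2) ((hv.continuous_fderiv one_ne_zero).norm.pow 2)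
  set I := ∫ x in W, v x ^ 2 with hIdef
  set D := ∫ x in W, ‖fderiv ℝ v x‖ ^ 2 with hDdef
  have hI0 : 0 ≤ I := integral_nonneg fun x => sq_nonneg _
  have hD0 : 0 ≤ D := integral_nonneg fun x => sq_nonneg _
  set c := min 1 (P / √(Real.pi * M)) with hc
  have hsq : 0 < √(Real.pi * M) := by positivity
  have hc0 : 0 ≤ c := by positivity
  have hcP : c * √(Real.pi * M) ≤ P := (le_div_iff₀ hsq).1 (min_le_right _ _)
  obtain ⟨y₀, hy₀, hz, hpos⟩ := besselEntire.exists_first_zero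
  have hsub : {x | v x ≠ 0} ∩ cylFund P ⊆ W :=
    inter_subset_inter_left _ fun x hx => by_contra fun h => hx (hvV x h)
  have hbound : ∀ K, 0 < K → K < 4 * Real.pi * y₀ / M → c ^ 2 * I * K ≤ D := by
    intro K hK hKM
    have h := faberKrahn_cylinder hP hpos hK hM ((lt_div_iff₀ hM).1 hKM) hv hper
      (fun x hx => hR x (by_contra fun h => hx (hvV x h))) ((measure_mono hsub).trans hMvol.le)
      hc0 (min_le_left _ _) hcP
    have h1 : ENNReal.ofReal (c ^ 2 * K) * ENNReal.ofReal I ≤ ENNReal.ofReal D := by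
      rw [hIdef, hDdef, ofReal_integral_eq_lintegral_ofReal hI (.of_forall fun x => sq_nonneg _),
        ofReal_integral_eq_lintegral_ofReal hD (.of_forall fun x => sq_nonneg _)]
      refine le_trans ?_ (h.trans (lintegral_mono_set hsub))
      gcongr
      exact inter_subset_right
    rw [← ENNReal.ofReal_mul (by positivity), ENNReal.ofReal_le_ofReal_iff hD0] at h1
    linarith
  have hB : 0 < 4 * Real.pi * y₀ / M := by positivity
  have hlim : Tendsto (fun K => c ^ 2 * I * K) (𝓝[<] (4 * Real.pi * y₀ / M))
      (𝓝 (c ^ 2 * I * (4 * Real.pi * y₀ / M))) :=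
    (continuous_const.mul continuous_id).continuousWithinAt
  have hle : c ^ 2 * I * (4 * Real.pi * y₀ / M) ≤ D := by
    refine le_of_tendsto hlim ?_
    filter_upwards [Ioo_mem_nhdsLT hB] with K hK using hbound K hK.1 hK.2
  refine le_trans ?_ hle
  have hL := lambda1Disk_le hy₀ hz hpos
  have : Real.pi * lambda1Disk / M ≤ 4 * Real.pi * y₀ / M := by
    refine div_le_div_of_nonneg_right ?_ hM.le
    nlinarith [Real.pi_pos]
  calc _ = c ^ 2 * I * (Real.pi * lambda1Disk / M) := by ring
    _ ≤ _ := by gcongr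

theorem min_le_cylArea_of_axial_bounded {P R : ℝ} (hP : 0 < P) {V : Set Pt} (hV : MeasurableSet V)
    (hR : ∀ x ∈ V, |x 0| ≤ R) (hlam : 0 < cylFirstDirichletEV P V) :
    min (Real.pi * lambda1Disk / cylFirstDirichletEV P V)
      (P * √lambda1Disk / √(cylFirstDirichletEV P V)) ≤ cylArea P V := by
  set lam := cylFirstDirichletEV P V with hlamdef
  have hL := lambda1Disk_nonneg
  unfold cylFirstDirichletEV at hlamdef
  have hne := nonempty_iff_ne_empty.2 fun h =>
    hlam.ne' (hlamdef.trans ((congrArg sInf h).trans Real.sInf_empty))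
  have hM : 0 < cylArea P V := by
    obtain ⟨r, v, hv, hper, hvV, hI, -⟩ := hne
    exact (rayleigh_le_dirichlet hP hV hR hv hper hvV hI).1
  have hge : min 1 (P / √(Real.pi * cylArea P V)) ^ 2 *
      (Real.pi * lambda1Disk / cylArea P V) ≤ lam := by
    rw [hlamdef]
    refine le_csInf hne ?_
    rintro r ⟨v, hv, hper, hvV, hI, rfl⟩
    rw [le_div_iff₀ (lt_of_le_of_ne (integral_nonneg fun x => sq_nonneg _) hI.symm)]
    exact (rayleigh_le_dirichlet hP hV hR hv hper hvV hI).2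
  set M := cylArea P V
  rcases min_choice 1 (P / √(Real.pi * M)) with h | h <;> rw [h] at hge
  · refine min_le_of_left_le ?_
    rw [one_pow, one_mul, div_le_iff₀ hM] at hge
    rw [div_le_iff₀ hlam]
    linarith
  · refine min_le_of_right_le ?_
    rw [div_pow, Real.sq_sqrt (by positivity)] at hge
    have h2 : P ^ 2 * lambda1Disk ≤ M ^ 2 * lam := by
      have : P ^ 2 / (Real.pi * M) * (Real.pi * lambda1Disk / M) =
          P ^ 2 * lambda1Disk / M ^ 2 := by
        field_simp
      rw [this, div_le_iff₀ (by positivity)] at hge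
      linarith
    rw [div_le_iff₀ (Real.sqrt_pos.2 hlam)]
    have h3 := Real.sqrt_le_sqrt h2
    rwa [Real.sqrt_mul (sq_nonneg P), Real.sqrt_mul (sq_nonneg M), Real.sqrt_sq hP.le,
      Real.sqrt_sq hM.le] at h3

theorem IsPeriodicSet.sub_zsmul_mem_iff {P : ℝ} {V : Set Pt} (h : IsPeriodicSet P V) (n : ℤ)
    (x : Pt) : x - n • cylShift P ∈ V ↔ x ∈ V := by
  have hf : Function.Periodic (fun x => x ∈ V) (cylShift P) := fun x => propext (h x).symm
  exact iff_of_eq (hf.sub_zsmul_eq n)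

theorem volume_axial_strip_inter_cylFund_le {P : ℝ} (p ρ : ℝ) {S : Set Pt}
    (hS : ∀ x ∈ S, |x 0 - p| < ρ) :
    volume (S ∩ cylFund P) ≤ ENNReal.ofReal P * ENNReal.ofReal (2 * ρ) := by
  have hsub : S ∩ cylFund P ⊆ ptProd ⁻¹' (Ico 0 P ×ˢ Ioo (p - ρ) (p + ρ)) := by
    rintro x ⟨hx, hxP⟩
    rw [mem_preimage, ptProd_apply]
    obtain ⟨h1, h2⟩ := abs_lt.1 (hS x hx)
    exact ⟨hxP, by linarith, by linarith⟩
  refine (measure_mono hsub).trans (le_of_eq ?_)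
  rw [measurePreserving_ptProd.measure_preimage
    (measurableSet_Ico.prod measurableSet_Ioo).nullMeasurableSet, Measure.volume_eq_prod,
    Measure.prod_prod, Real.volume_Ico, Real.volume_Ioo, sub_zero]
  congr 2
  ring

/-- Bump functions on the cylinder. -/
theorem exists_isCylTest_bump {P : ℝ} (hP : 0 < P) {V : Set Pt} (hV : IsOpen V)
    (hper : IsPeriodicSet P V) {x : Pt} (hx : x ∈ V) {δ : ℝ} (hδ : 0 < δ) :
    ∃ ψ : Pt → ℝ, ContDiff ℝ 1 ψ ∧ IsPeriodicFun P ψ ∧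
      (∀ y, ψ y ≠ 0 → y ∈ V ∧ |y 0 - x 0| < δ) ∧ 0 < ψ x := by
  obtain ⟨r, hr, hball⟩ := Metric.isOpen_iff.1 hV x hx
  set ρ := min δ (r / (1 + P / 2)) with hρdef
  have hρ : 0 < ρ := by positivity
  set g : Pt → ℝ := fun y => (y 0 - x 0) ^ 2 + Real.sin (Real.pi * (y 1 - x 1) / P) ^ 2 with hg
  have hgc : ContDiff ℝ 1 g := by fun_prop
  have hlt : ∀ y, Real.smoothTransition (1 - g y / ρ ^ 2) ≠ 0 →
      |y 0 - x 0| < ρ ∧ |Real.sin (Real.pi * (y 1 - x 1) / P)| < ρ := by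
    intro y hy
    rw [Ne, Real.smoothTransition.zero_iff_nonpos, not_le, sub_pos, div_lt_one (by positivity)] at hy
    simp only [hg] at hy
    exact ⟨abs_lt_of_sq_lt_sq (by nlinarith [sq_nonneg (Real.sin (Real.pi * (y 1 - x 1) / P))]) hρ.le,
      abs_lt_of_sq_lt_sq (by nlinarith [sq_nonneg (y 0 - x 0)]) hρ.le⟩
  refine ⟨fun y => Real.smoothTransition (1 - g y / ρ ^ 2), ?_, fun y => ?_, fun y hy => ?_, ?_⟩
  · exact Real.smoothTransition.contDiff.comp (contDiff_const.sub (hgc.div_const _))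
  · have : g (y + cylShift P) = g y := by
      have h1 : Real.pi * ((y + cylShift P) 1 - x 1) / P =
          Real.pi * (y 1 - x 1) / P + Real.pi := by
        simp [cylShift]
        field_simp
        ring
      simp only [hg]
      rw [h1, Real.sin_add_pi, neg_sq]
      simp [cylShift]
    simp only [this]
  · obtain ⟨h0, h1⟩ := hlt y hy
    refine ⟨?_, h0.trans_le (min_le_left _ _)⟩
    obtain ⟨n, hn, -⟩ := existsUnique_sub_zsmul_mem_Ico hP (y 1 - x 1) (-(P / 2))
    rw [← hper.sub_zsmul_mem_iff n]
    refine hball ?_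
    set t := y 1 - x 1 - n • P with ht
    have ht2 : |t| ≤ P / 2 := abs_le.2 ⟨hn.1, by linarith [hn.2]⟩
    have hsin : |Real.sin (Real.pi * t / P)| = |Real.sin (Real.pi * (y 1 - x 1) / P)| := by
      have : Real.pi * t / P = Real.pi * (y 1 - x 1) / P - n * Real.pi := by
        rw [ht, zsmul_eq_mul]
        field_simp
      rw [this, Real.sin_sub_int_mul_pi, abs_mul]
      simp
    have habs : |Real.pi * t / P| = Real.pi * |t| / P := by
      rw [abs_div, abs_mul, abs_of_pos Real.pi_pos, abs_of_pos hP]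
    have hle : |Real.pi * t / P| ≤ Real.pi / 2 := by
      rw [habs, div_le_iff₀ hP]
      nlinarith [Real.pi_pos]
    have hjor := Real.mul_abs_le_abs_sin hle
    have he : 2 / Real.pi * (Real.pi * |t| / P) = 2 * |t| / P := by
      field_simp
    rw [habs, hsin, he, div_le_iff₀ hP] at hjor
    have hρr : ρ * (1 + P / 2) ≤ r := (le_div_iff₀ (by positivity)).1 (min_le_right _ _)
    have e0 : (y - n • cylShift P - x) 0 = y 0 - x 0 := by simp [cylShift]
    have e1 : (y - n • cylShift P - x) 1 = t := by
      simp [cylShift, ht]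
      ring
    rw [mem_ball, dist_eq_norm, EuclideanSpace.norm_eq, Fin.sum_univ_two, e0, e1,
      Real.norm_eq_abs, Real.norm_eq_abs]
    calc √(|y 0 - x 0| ^ 2 + |t| ^ 2) ≤ √((|y 0 - x 0| + |t|) ^ 2) := by
          refine Real.sqrt_le_sqrt ?_
          nlinarith [mul_nonneg (abs_nonneg (y 0 - x 0)) (abs_nonneg t)]
      _ = |y 0 - x 0| + |t| := Real.sqrt_sq (by positivity)
      _ < r := by nlinarith
  · have : g x = 0 := by simp [hg]
    simp [this]

/-- Functions of small mass and large Dirichlet energy concentrated near a point. -/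
theorem exists_concentrated_isCylTest {P : ℝ} (hP : 0 < P) {V : Set Pt} (hV : IsOpen V)
    (hper : IsPeriodicSet P V) {x : Pt} (hx : x ∈ V) {ε : ℝ} (hε : 0 < ε) :
    ∃ φ : Pt → ℝ, ContDiff ℝ 1 φ ∧ IsPeriodicFun P φ ∧
      (∀ y, φ y ≠ 0 → y ∈ V ∧ |y 0 - x 0| < 1) ∧
      (∫⁻ y in cylFund P, ENNReal.ofReal (φ y ^ 2)) = ENNReal.ofReal ε ∧
      1 ≤ ∫⁻ y in {y | φ y ≠ 0} ∩ cylFund P, ENNReal.ofReal (‖fderiv ℝ φ y‖ ^ 2) := by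
  obtain ⟨y₀, hy₀, -, hpos⟩ := besselEntire.exists_first_zero
  have hpi := Real.pi_pos
  set M := min (2 * Real.pi * y₀ * ε) (P ^ 2 / Real.pi) with hM
  have hM0 : 0 < M := by positivity
  have hδ : 0 < min 1 (M / (2 * P)) := by positivity
  obtain ⟨ψ, hψ, hψper, hψV, hψx⟩ := exists_isCylTest_bump hP hV hper hx hδ
  have hψ0 : ∀ y, ψ y ≠ 0 → |y 0| ≤ |x 0| + 1 := fun y hy => by
    have := (hψV y hy).2.le.trans (min_le_left _ _)
    have h2 := abs_sub_abs_le_abs_sub (y 0) (x 0)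
    linarith
  have hψt : IsCylTest P (|x 0| + 1) ψ := ⟨hψ, hψper, hψ0⟩
  set u : Pt → ℝ := fun y => ψ y ^ 2 with hu
  have huc : Continuous u := hψ.continuous.pow 2
  have hint : IntegrableOn u (cylFund P) := by
    have h1 : IntegrableOn u (closure ({y : Pt | |y 0| ≤ |x 0| + 1} ∩ cylFund P)) :=
      huc.continuousOn.integrableOn_compact (isBounded_axial_inter_cylFund P _).isCompact_closure
    refine (h1.mono_set subset_closure).of_forall_sdiff_eq_zero (measurableSet_cylFund P) ?_
    intro y hy
    by_contra hne
    exact hy.2 ⟨hψ0 y fun h => hne (by simp [hu, h]), hy.1⟩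
  set m := ∫ y in cylFund P, u y with hm
  have hmlin : ∫⁻ y in cylFund P, ENNReal.ofReal (u y) = ENNReal.ofReal m :=
    (ofReal_integral_eq_lintegral_ofReal hint (.of_forall fun y => sq_nonneg _)).symm
  have hm0 : 0 < m := by
    rw [hm, setIntegral_pos_iff_support_of_nonneg_ae (.of_forall fun y => sq_nonneg _) hint]
    have hopen : IsOpen (Function.support u) := isOpen_ne_fun huc continuous_const
    have hsupper : IsPeriodicSet P (Function.support u) := fun y => by
      simp only [Function.mem_support, hu, hψper y]
    rw [volume_inter_cylFund_eq hP hopen.measurableSet hsupper (x 1 - P / 2)]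
    refine (hopen.inter (isOpen_Ioo.preimage (f := fun y : Pt => y 1) (by fun_prop))).measure_pos _
      ⟨x, (pow_pos hψx 2).ne', ?_, ?_⟩ <;> linarith
  have hεm : 0 ≤ ε / m := by positivity
  set φ : Pt → ℝ := fun y => √(ε / m) * ψ y with hφ
  have hφc : ContDiff ℝ 1 φ := contDiff_const.mul hψ
  have hφper : IsPeriodicFun P φ := fun y => by simp only [hφ, hψper y]
  have hφψ : ∀ y, φ y ≠ 0 → ψ y ≠ 0 := fun y hy => right_ne_zero_of_mul hy
  have hmass : (∫⁻ y in cylFund P, ENNReal.ofReal (φ y ^ 2)) = ENNReal.ofReal ε := by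
    simp only [hφ, mul_pow, Real.sq_sqrt hεm, ENNReal.ofReal_mul hεm]
    rw [lintegral_const_mul _ huc.measurable.ennreal_ofReal, hmlin, ← ENNReal.ofReal_mul hεm,
      div_mul_cancel₀ _ hm0.ne']
  refine ⟨φ, hφc, hφper, fun y hy => ?_, hmass, ?_⟩
  · obtain ⟨h1, h2⟩ := hψV y (right_ne_zero_of_mul hy)
    exact ⟨h1, h2.trans_le (min_le_left _ _)⟩
  · have hvol : volume ({y | φ y ≠ 0} ∩ cylFund P) ≤ ENNReal.ofReal M := by
      refine (volume_axial_strip_inter_cylFund_le (x 0) (min 1 (M / (2 * P)))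
        fun y hy => (hψV y (hφψ y hy)).2).trans ?_
      rw [← ENNReal.ofReal_mul hP.le]
      refine ENNReal.ofReal_le_ofReal ?_
      calc P * (2 * min 1 (M / (2 * P))) ≤ P * (2 * (M / (2 * P))) := by
            gcongr
            exact min_le_right _ _
        _ = M := by field_simp
    have hMP : 1 * √(Real.pi * M) ≤ P := by
      rw [one_mul, Real.sqrt_le_left hP.le, mul_comm]
      exact (le_div_iff₀ hpi).1 (min_le_right _ _)
    have hKM : ε⁻¹ * M < 4 * Real.pi * y₀ := by
      have h1 : M ≤ 2 * Real.pi * y₀ * ε := min_le_left _ _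
      rw [inv_mul_lt_iff₀ hε]
      nlinarith [mul_pos (mul_pos hpi hy₀) hε]
    have h := faberKrahn_cylinder hP hpos (inv_pos.2 hε) hM0 hKM hφc hφper
      (fun y hy => hψ0 y (hφψ y hy)) hvol zero_le_one le_rfl hMP
    rwa [hmass, one_pow, one_mul, ← ENNReal.ofReal_mul (by positivity), inv_mul_cancel₀ hε.ne',
      ENNReal.ofReal_one] at h

theorem cylFirstDirichletEV_nonneg (P : ℝ) (V : Set Pt) : 0 ≤ cylFirstDirichletEV P V := by
  refine Real.sInf_nonneg ?_
  rintro _ ⟨w, -, -, -, -, rfl⟩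
  exact div_nonneg (integral_nonneg fun y => sq_nonneg _) (integral_nonneg fun y => sq_nonneg _)

/-- On an axially unbounded set there is a test function of finite mass whose Dirichlet energy is
infinite; the Bochner integral of the energy density then vanishes. -/
theorem cylFirstDirichletEV_eq_zero_of_unbounded {P : ℝ} (hP : 0 < P) {V : Set Pt} (hV : IsOpen V)
    (hper : IsPeriodicSet P V) (hR : ∀ R, ∃ x ∈ V, R < |x 0|) :
    cylFirstDirichletEV P V = 0 := by
  obtain ⟨x, hxV, hx⟩ := exists_seq_of_forall_finset_exists (· ∈ V)
    (fun a b : Pt => |a 0| + 2 ≤ |b 0|) fun s _ => by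
      obtain ⟨y, hy, hlt⟩ := hR (∑ a ∈ s, |a 0| + 2)
      refine ⟨y, hy, fun a ha => ?_⟩
      have := Finset.single_le_sum (f := fun a : Pt => |a 0|) (fun i _ => abs_nonneg _) ha
      dsimp only at this
      linarith
  have hgrow : ∀ n : ℕ, 2 * (n : ℝ) ≤ |x n 0| := fun n => by
    induction n with
    | zero => simp
    | succ n ih =>
      have := hx n (n + 1) n.lt_succ_self
      push_cast
      linarith
  choose φ hφc hφper hφV hmass henergy using fun n : ℕ =>
    exists_concentrated_isCylTest hP hV hper (hxV n) (ε := (1 / 2) ^ n) (by positivity)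
  have huniq : ∀ m n y, φ m y ≠ 0 → φ n y ≠ 0 → m = n := by
    have key : ∀ m n y, m < n → φ m y ≠ 0 → φ n y ≠ 0 → False := by
      intro m n y hmn hm hn
      have h1 := (hφV m y hm).2
      have h2 := (hφV n y hn).2
      have h3 := hx m n hmn
      have h4 := abs_sub_abs_le_abs_sub (x n 0) (y 0)
      have h5 := abs_sub_abs_le_abs_sub (y 0) (x m 0)
      rw [abs_sub_comm (x n 0)] at h4
      linarith
    intro m n y hm hn
    by_contra hne
    rcases lt_or_gt_of_ne hne with h | h
    exacts [key m n y h hm hn, key n m y h hn hm]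
  set v : Pt → ℝ := fun y => ∑' n, φ n y with hv
  have hv_eq : ∀ n y, φ n y ≠ 0 → v y = φ n y := fun n y hn =>
    tsum_eq_single n fun m hm => by_contra fun h => hm (huniq m n y h hn)
  have hv_ne : ∀ y, v y ≠ 0 → ∃ n, φ n y ≠ 0 := fun y hy => by
    by_contra! h
    exact hy (by simp [hv, h])
  have hvc : ContDiff ℝ 1 v := by
    refine contDiff_iff_contDiffAt.2 fun y => ?_
    obtain ⟨N, hN⟩ := exists_nat_ge (|y 0| + 2)
    have hsum : ContDiff ℝ 1 fun z => ∑ n ∈ Finset.range N, φ n z :=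
      ContDiff.sum fun n _ => hφc n
    refine hsum.contDiffAt.congr_of_eventuallyEq ?_
    filter_upwards [ball_mem_nhds y one_pos] with z hz
    refine tsum_eq_sum fun n hn => ?_
    by_contra hne
    have hn : (N : ℝ) ≤ n := by exact_mod_cast not_lt.1 fun h => hn (Finset.mem_range.2 h)
    have h1 := (hφV n z hne).2
    have h2 := (abs_coord_sub_le z y 0).trans_lt hz
    have h3 := hgrow n
    have h4 := abs_sub_abs_le_abs_sub (x n 0) (z 0)
    have h5 := abs_sub_abs_le_abs_sub (z 0) (y 0)
    rw [abs_sub_comm (x n 0)] at h4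
    have h6 := abs_nonneg (y 0)
    linarith
  have hvper : IsPeriodicFun P v := fun y => by simp only [hv, hφper _ y]
  have hvV : ∀ y ∉ V, v y = 0 := fun y hy => by
    by_contra hne
    obtain ⟨n, hn⟩ := hv_ne y hne
    exact hy (hφV n y hn).1
  set W := V ∩ cylFund P with hW
  have hmeas : ∀ n, Measurable fun y => ENNReal.ofReal (φ n y ^ 2) := fun n =>
    ((hφc n).continuous.pow 2).measurable.ennreal_ofReal
  have hvmeas : Measurable fun y => v y ^ 2 := (hvc.continuous.pow 2).measurable
  have hfin : ∫⁻ y in W, ENNReal.ofReal (v y ^ 2) < ∞ := by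
    calc _ ≤ ∫⁻ y in cylFund P, ∑' n, ENNReal.ofReal (φ n y ^ 2) := by
          refine (lintegral_mono_set inter_subset_right).trans (lintegral_mono fun y => ?_)
          by_cases hy : v y = 0
          · simp [hy]
          obtain ⟨n, hn⟩ := hv_ne y hy
          dsimp only
          rw [hv_eq n y hn]
          exact ENNReal.le_tsum n
      _ = ∑' n : ℕ, ENNReal.ofReal ((1 / 2) ^ n) := by
          rw [lintegral_tsum fun n => (hmeas n).aemeasurable]
          simp only [hmass]
      _ < ∞ := by
          rw [← ENNReal.ofReal_tsum_of_nonneg (fun n => by positivity) summable_geometric_two]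
          exact ENNReal.ofReal_lt_top
  have hint : IntegrableOn (fun y => v y ^ 2) W :=
    ⟨hvmeas.aestronglyMeasurable, (hasFiniteIntegral_iff_ofReal
      (.of_forall fun y => sq_nonneg _)).2 hfin⟩
  have hne : (∫ y in W, v y ^ 2) ≠ 0 := by
    intro h0
    have h1 := ofReal_integral_eq_lintegral_ofReal hint (.of_forall fun y => sq_nonneg _)
    rw [h0, ENNReal.ofReal_zero] at h1
    have h2 : ∫⁻ y in cylFund P, ENNReal.ofReal (φ 0 y ^ 2) ≤
        ∫⁻ y in W, ENNReal.ofReal (v y ^ 2) := by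
      rw [hW, ← Measure.restrict_restrict hV.measurableSet, ← lintegral_indicator hV.measurableSet]
      refine lintegral_mono fun y => ?_
      by_cases hy : φ 0 y = 0
      · simp [hy]
      · rw [indicator_of_mem (hφV 0 y hy).1, hv_eq 0 y hy]
    rw [hmass, ← h1] at h2
    simp at h2
  have hopen : ∀ n, IsOpen {y | φ n y ≠ 0} := fun n =>
    isOpen_ne_fun (hφc n).continuous continuous_const
  have hinf : ∫⁻ y in W, ENNReal.ofReal (‖gradient v y‖ ^ 2) = ∞ := by
    simp only [norm_gradient_eq_norm_fderiv]
    rw [eq_top_iff]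
    calc (∞ : ℝ≥0∞) = ∑' _ : ℕ, 1 := (ENNReal.tsum_const_eq_top_of_ne_zero one_ne_zero).symm
      _ ≤ ∑' n, ∫⁻ y in {y | φ n y ≠ 0} ∩ cylFund P, ENNReal.ofReal (‖fderiv ℝ v y‖ ^ 2) := by
          refine ENNReal.tsum_le_tsum fun n => (henergy n).trans (le_of_eq ?_)
          refine setLIntegral_congr_fun
            ((hopen n).measurableSet.inter (measurableSet_cylFund P)) fun y hy => ?_
          have : v =ᶠ[𝓝 y] φ n := by
            filter_upwards [(hopen n).mem_nhds hy.1] with z hz using hv_eq n z hz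
          rw [this.fderiv_eq]
      _ = ∫⁻ y in ⋃ n, {y | φ n y ≠ 0} ∩ cylFund P, ENNReal.ofReal (‖fderiv ℝ v y‖ ^ 2) := by
          refine (lintegral_iUnion
            (fun n => (hopen n).measurableSet.inter (measurableSet_cylFund P)) ?_ _).symm
          exact fun m n hmn => disjoint_left.2 fun y hm hn => hmn (huniq m n y hm.1 hn.1)
      _ ≤ _ := lintegral_mono_set (iUnion_subset fun n =>
          inter_subset_inter_left _ fun y hy => (hφV n y hy).1)
  have hzero : ∫ y in W, ‖gradient v y‖ ^ 2 = 0 := by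
    refine integral_undef fun hi => ?_
    have := (hasFiniteIntegral_iff_ofReal (.of_forall fun y => sq_nonneg _)).1 hi.2
    exact this.ne hinf
  refine le_antisymm ?_ (cylFirstDirichletEV_nonneg P V)
  refine csInf_le ⟨0, ?_⟩ ⟨v, hvc, hvper, hvV, hne, (by rw [hzero, zero_div])⟩
  rintro _ ⟨w, -, -, -, -, rfl⟩
  exact div_nonneg (integral_nonneg fun y => sq_nonneg _) (integral_nonneg fun y => sq_nonneg _)

end

/-- Lemma 6.3, Faber–Krahn on the flat cylinder. Let `𝒞_P` be the flat
infinite cylinder of circumference `P > 0` (encoded by `P`-periodic subsets of the plane), and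
let `V` be a Lipschitz set on `𝒞_P` with first Dirichlet eigenvalue `λ`. Then
`Area(V) ≥ min{ π λ₁(𝔻) λ⁻¹ , P λ₁(𝔻)^{1/2} λ^{−1/2} }`. -/
theorem statement14 (P : ℝ) (hP : 0 < P) (V : Set Pt)
    (hper : IsPeriodicSet P V) (hlip : HasLipschitzBoundary V)
    (lam : ℝ) (hlam : lam = cylFirstDirichletEV P V) :
    min (Real.pi * lambda1Disk / lam) (P * Real.sqrt lambda1Disk / Real.sqrt lam) ≤
      cylArea P V := by
  subst hlam
  rcases (cylFirstDirichletEV_nonneg P V).eq_or_lt with h | h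
  · rw [← h, Real.sqrt_zero, div_zero, div_zero, min_self]
    exact ENNReal.toReal_nonneg
  by_cases hR : ∃ R, ∀ x ∈ V, |x 0| ≤ R
  · obtain ⟨R, hR⟩ := hR
    exact min_le_cylArea_of_axial_bounded hP hlip.isOpen.measurableSet hR h
  · push Not at hR
    exact absurd (cylFirstDirichletEV_eq_zero_of_unbounded hP hlip.isOpen hper hR) h.ne'

end
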